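/- There exist constants C₁, C₂ > 0 such that for all real numbers a, b > 0 the following two assertions hold: (i) for all bounded self-adjoint operators A, B on any complex Hilbert space with spectra contained in (−b, 0] ∪ [a, ∞), one has ‖ |A| − |B| ‖ ≤ C₂ · log(2 + max(log(b/a), 0)) · ‖A − B‖; (ii) there exist bounded self-adjoint operators A, B on ℓ²(ℕ, ℂ) with spectra contained in (−b, 0] ∪ [a, ∞), with A ≠ B, such that ‖ |A| − |B| ‖ ≥ C₁ · log(2 + max(log(b/a), 0)) · ‖A − B‖. -/

import Mathlib

open MeasureTheory ENNReal

/-- `|T| = (T*T)^{1/2}` via the continuous functional calculus. -/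
noncomputable def opAbs {H : Type} [NormedAddCommGroup H] [InnerProductSpace ℂ H]
    [CompleteSpace H] (T : H →L[ℂ] H) : H →L[ℂ] H :=
  cfc Real.sqrt (star T * T)

/-- The Hilbert space `ℓ²(ℕ, ℂ)`. -/
noncomputable abbrev ellTwo : Type := lp (fun _ : ℕ => ℂ) 2

open ContinuousLinearMap
section Kernel

variable {H : Type*} [NormedAddCommGroup H] [InnerProductSpace ℂ H] [CompleteSpace H]

/-- The Sylvester map `X ↦ A X + X B`. -/
def sylvester {R : Type*} [Ring R] (A B X : R) : R := A * X + X * B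

/-- The semigroup `t ↦ exp (-t A)`. -/
noncomputable def decay (A : H →L[ℂ] H) (t : ℝ) : H →L[ℂ] H := NormedSpace.exp (t • (-A))

lemma decay_zero (A : H →L[ℂ] H) : decay A 0 = 1 := by simp [decay]

lemma commute_decay {A m : H →L[ℂ] H} (h : Commute m A) (t : ℝ) : Commute m (decay A t) :=
  ((h.neg_right).smul_right t).exp_right

lemma hasDerivAt_decay (A : H →L[ℂ] H) (t : ℝ) :
    HasDerivAt (decay A) (-A * decay A t) t :=
  hasDerivAt_exp_smul_const' (𝕂 := ℝ) (-A) t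

lemma hasDerivAt_decay_apply (A : H →L[ℂ] H) (f : H) (t : ℝ) :
    HasDerivAt (fun s => decay A s f) (-A (decay A t f)) t := by
  have h := hasDerivAt_decay A t
  have := ((ContinuousLinearMap.apply ℂ H f).restrictScalars ℝ).hasFDerivAt.comp_hasDerivAt t h
  exact this.congr_deriv (by simp)

lemma norm_decay_le {A : H →L[ℂ] H} (hA : IsSelfAdjoint A) {a : ℝ}
    (ha : spectrum ℝ A ⊆ Set.Ici a) {t : ℝ} (ht : 0 ≤ t) :
    ‖decay A t‖ ≤ Real.exp (-(t * a)) := by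
  have h1 : decay A t = cfc (fun x : ℝ => Real.exp (t * (-x))) A := by
    have : IsSelfAdjoint (t • (-A)) := IsSelfAdjoint.smul (IsSelfAdjoint.all t) hA.neg
    rw [decay, ← CFC.real_exp_eq_normedSpace_exp this]
    have h2 : t • (-A) = cfc (fun x : ℝ => t * (-x)) A := by
      rw [cfc_const_mul t (fun x : ℝ => -x) A, cfc_neg_id A hA]
    rw [h2, ← cfc_comp' Real.exp (fun x : ℝ => t * (-x)) A]
  rw [h1]
  refine norm_cfc_le (Real.exp_pos _).le fun x hx => ?_
  rw [Real.norm_eq_abs, abs_of_pos (Real.exp_pos _)]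
  have := ha hx
  simp only [Set.mem_Ici] at this
  have h3 := mul_le_mul_of_nonneg_left this ht
  exact Real.exp_le_exp.2 (by linarith)

/-- The real part of the sesquilinear form of `T` along the two semigroups. -/
noncomputable def form (A B : H →L[ℂ] H) (f g : H) (T : H →L[ℂ] H) (t : ℝ) : ℝ :=
  RCLike.re (inner ℂ (decay A t f) (T (decay B t g)))

lemma hasDerivAt_form {A B : H →L[ℂ] H} (hA : IsSelfAdjoint A) (f g : H) (T : H →L[ℂ] H)
    (t : ℝ) : HasDerivAt (form A B f g T) (-form A B f g (sylvester A B T) t) t := by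
  have hx := hasDerivAt_decay_apply A f t
  have hy := hasDerivAt_decay_apply B g t
  have hTy := (T.restrictScalars ℝ).hasFDerivAt.comp_hasDerivAt t hy
  have h := hx.inner ℂ hTy
  have h2 := (Complex.reCLM).hasFDerivAt.comp_hasDerivAt t h
  refine h2.congr_deriv ?_
  have hs : ∀ u v : H, inner ℂ (A u) v = inner ℂ u (A v) := fun u v => hA.isSymmetric u v
  simp [form, sylvester, hs]

lemma abs_form_le {A B : H →L[ℂ] H} (hA : IsSelfAdjoint A) (hB : IsSelfAdjoint B) {a b : ℝ}
    (ha : spectrum ℝ A ⊆ Set.Ici a) (hb : spectrum ℝ B ⊆ Set.Ici b) (f g : H)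
    (T : H →L[ℂ] H) {t : ℝ} (ht : 0 ≤ t) :
    |form A B f g T t| ≤ Real.exp (-(t * (a + b))) * (‖f‖ * ‖T‖ * ‖g‖) := by
  have h1 : ‖decay A t f‖ ≤ Real.exp (-(t * a)) * ‖f‖ :=
    ((decay A t).le_opNorm f).trans (by gcongr; exact norm_decay_le hA ha ht)
  have h2 : ‖decay B t g‖ ≤ Real.exp (-(t * b)) * ‖g‖ :=
    ((decay B t).le_opNorm g).trans (by gcongr; exact norm_decay_le hB hb ht)
  calc |form A B f g T t| ≤ ‖decay A t f‖ * ‖T (decay B t g)‖ :=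
        (RCLike.abs_re_le_norm _).trans (norm_inner_le_norm _ _)
    _ ≤ ‖decay A t f‖ * (‖T‖ * ‖decay B t g‖) := by gcongr; exact T.le_opNorm _
    _ ≤ (Real.exp (-(t * a)) * ‖f‖) * (‖T‖ * (Real.exp (-(t * b)) * ‖g‖)) := by gcongr
    _ = _ := by rw [mul_add, neg_add, Real.exp_add]; ring

/-- Comparison principle: a majorant `G` of the damped double primitive bounds the form. -/
lemma re_inner_le_of_majorant {A B : H →L[ℂ] H} (hA : IsSelfAdjoint A) (hB : IsSelfAdjoint B)
    {a : ℝ} (ha0 : 0 < a) (ha : spectrum ℝ A ⊆ Set.Ici a) (hb : spectrum ℝ B ⊆ Set.Ici 0)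
    (f g : H) (W : H →L[ℂ] H) (G D : ℝ → ℝ) (hG : ∀ t, 0 ≤ t → 0 ≤ G t)
    (hGD : ∀ t, HasDerivAt G (-D t) t)
    (hD : ∀ t, 0 ≤ t → t * |form A B f g (sylvester A B (sylvester A B W)) t| ≤ D t) :
    RCLike.re (inner ℂ f (W g)) ≤ G 0 := by
  set F : ℝ → ℝ := fun t => form A B f g W t + t * form A B f g (sylvester A B W) t with hF
  have hFd : ∀ t, HasDerivAt F (-(t * form A B f g (sylvester A B (sylvester A B W)) t)) t := by
    intro t
    have h := (hasDerivAt_form (B := B) hA f g W t).add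
      ((hasDerivAt_id t).mul (hasDerivAt_form (B := B) hA f g (sylvester A B W) t))
    refine h.congr_deriv ?_
    simp
  have hmono : MonotoneOn (fun t => F t - G t) (Set.Ici 0) := by
    refine monotoneOn_of_deriv_nonneg (convex_Ici 0) ?_ ?_ ?_
    · exact fun t _ => ((hFd t).sub (hGD t)).continuousAt.continuousWithinAt
    · exact fun t _ => ((hFd t).sub (hGD t)).differentiableAt.differentiableWithinAt
    · intro t ht
      rw [interior_Ici] at ht
      have h0 : (0 : ℝ) ≤ t := le_of_lt ht
      have : deriv (fun t => F t - G t) t = _ := ((hFd t).sub (hGD t)).deriv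
      rw [this]
      have h1 := hD t h0
      have h2 := mul_le_mul_of_nonneg_left
        (le_abs_self (form A B f g (sylvester A B (sylvester A B W)) t)) h0
      linarith
  have hlim : Filter.Tendsto F Filter.atTop (nhds 0) := by
    have key : ∀ T : H →L[ℂ] H, ∀ n : ℕ,
        Filter.Tendsto (fun t => t ^ n * form A B f g T t) Filter.atTop (nhds 0) := by
      intro T n
      have h1 : Filter.Tendsto (fun t : ℝ => (t ^ n * Real.exp (-a * t)) * (‖f‖ * ‖T‖ * ‖g‖))
          Filter.atTop (nhds 0) := by
        simpa using (tendsto_rpow_mul_exp_neg_mul_atTop_nhds_zero n a ha0).mul_const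
          (‖f‖ * ‖T‖ * ‖g‖)
      refine squeeze_zero_norm' ?_ h1
      filter_upwards [Filter.eventually_ge_atTop 0] with t ht
      have := abs_form_le hA hB ha hb f g T ht
      rw [norm_mul, Real.norm_eq_abs, Real.norm_eq_abs, abs_of_nonneg (pow_nonneg ht n), mul_assoc]
      gcongr
      refine this.trans_eq ?_
      congr 2
      ring
    simpa using (key W 0).add (key (sylvester A B W) 1)
  have hle : ∀ t, 0 ≤ t → F 0 - G 0 ≤ F t := by
    intro t ht
    have := hmono (Set.mem_Ici.2 le_rfl) (Set.mem_Ici.2 ht) ht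
    have h2 := hG t ht
    simp only at this
    linarith
  have h0 : F 0 - G 0 ≤ 0 :=
    ge_of_tendsto hlim ((Filter.eventually_ge_atTop 0).mono hle)
  have hF0 : F 0 = RCLike.re (inner ℂ f (W g)) := by
    simp [hF, form, decay_zero]
  linarith

/-- The quadratic form of `m ^ (2 j)` along the semigroup generated by `m ^ 2`. -/
noncomputable def energy (m : H →L[ℂ] H) (f : H) (j : ℕ) : ℝ → ℝ :=
  form (m ^ 2) (m ^ 2) f f (m ^ (2 * j))

lemma hasDerivAt_energy {m : H →L[ℂ] H} (hm : IsSelfAdjoint m) (f : H) (j : ℕ) (t : ℝ) :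
    HasDerivAt (energy m f j) (-(2 * energy m f (j + 1) t)) t := by
  refine (hasDerivAt_form (hm.pow 2) f f (m ^ (2 * j)) t).congr_deriv ?_
  have : sylvester (m ^ 2) (m ^ 2) (m ^ (2 * j)) = m ^ (2 * (j + 1)) + m ^ (2 * (j + 1)) := by
    rw [sylvester, ← pow_add, ← pow_add, show 2 * j + 2 = 2 * (j + 1) by ring,
      show 2 + 2 * j = 2 * (j + 1) by ring]
  simp [energy, form, this]
  ring

lemma energy_eq {m : H →L[ℂ] H} (hm : IsSelfAdjoint m) (f : H) (j : ℕ) (t : ℝ) :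
    energy m f j t = ‖decay (m ^ 2) t ((m ^ j) f)‖ ^ 2 := by
  have h1 : decay (m ^ 2) t ((m ^ j) f) = (m ^ j) (decay (m ^ 2) t f) := by
    have : Commute (m ^ j) (decay (m ^ 2) t) := commute_decay (Commute.pow_pow_self m j 2) t
    exact (congrArg (fun T : H →L[ℂ] H => T f) this.eq).symm
  have h2 : (m ^ (2 * j)) (decay (m ^ 2) t f) = (m ^ j) ((m ^ j) (decay (m ^ 2) t f)) := by
    rw [two_mul, pow_add]; rfl
  have hs : ∀ u v : H, inner ℂ ((m ^ j) u) v = inner ℂ u ((m ^ j) v) :=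
    fun u v => (hm.pow j).isSymmetric u v
  rw [h1, energy, form, h2, ← hs, ← norm_sq_eq_re_inner]

/-- A primitive of `-t ^ i` times the energy of order `i + 1`. -/
noncomputable def energyPrimitive (m : H →L[ℂ] H) (f : H) : ℕ → ℝ → ℝ
  | 0 => fun t => (1 / 2) * energy m f 0 t
  | i + 1 => fun t => (1 / 2) * (t ^ (i + 1) * energy m f (i + 1) t) +
      ((i + 1 : ℝ) / 2) * energyPrimitive m f i t

lemma hasDerivAt_energyPrimitive {m : H →L[ℂ] H} (hm : IsSelfAdjoint m) (f : H) (i : ℕ) (t : ℝ) :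
    HasDerivAt (energyPrimitive m f i) (-(t ^ i * energy m f (i + 1) t)) t := by
  induction i with
  | zero =>
    refine ((hasDerivAt_energy hm f 0 t).const_mul (1 / 2 : ℝ)).congr_deriv ?_
    ring
  | succ i ih =>
    refine ((((hasDerivAt_pow (i + 1) t).mul (hasDerivAt_energy hm f (i + 1) t)).const_mul
      (1 / 2 : ℝ)).add (ih.const_mul ((i + 1 : ℝ) / 2))).congr_deriv ?_
    push_cast
    ring

lemma energyPrimitive_nonneg {m : H →L[ℂ] H} (hm : IsSelfAdjoint m) (f : H) (i : ℕ) {t : ℝ}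
    (ht : 0 ≤ t) : 0 ≤ energyPrimitive m f i t := by
  induction i with
  | zero => simp only [energyPrimitive, energy_eq hm]; positivity
  | succ i ih => simp only [energyPrimitive, energy_eq hm]; positivity

lemma energyPrimitive_zero {m : H →L[ℂ] H} (hm : IsSelfAdjoint m) (f : H) (i : ℕ) :
    energyPrimitive m f i 0 = (i.factorial / 2 ^ (i + 1) : ℝ) * ‖f‖ ^ 2 := by
  induction i with
  | zero => simp [energyPrimitive, energy_eq hm, decay_zero]
  | succ i ih =>
    simp only [energyPrimitive, ih, Nat.factorial_succ]
    push_cast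
    ring

omit [CompleteSpace H] in
lemma opNorm_le_of_re_inner_le (T : H →L[ℂ] H) {c₁ c₂ : ℝ} (h1 : 0 ≤ c₁) (h2 : 0 ≤ c₂)
    (h : ∀ f g : H, RCLike.re (inner ℂ f (T g)) ≤ c₁ * ‖f‖ ^ 2 + c₂ * ‖g‖ ^ 2) :
    ‖T‖ ≤ c₁ + c₂ := by
  refine T.opNorm_le_of_unit_norm (by positivity) fun g hg => ?_
  rcases eq_or_ne (T g) 0 with h0 | h0
  · rw [h0, norm_zero]; positivity
  have hpos : 0 < ‖T g‖ := norm_pos_iff.2 h0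
  have := h (((‖T g‖⁻¹ : ℝ) : ℂ) • T g) g
  rw [inner_smul_left, norm_smul, hg, inner_self_eq_norm_sq_to_K] at this
  simp only [Complex.conj_ofReal, Complex.norm_real, norm_inv, norm_norm,
    inv_mul_cancel₀ hpos.ne'] at this
  have e : RCLike.re (((‖T g‖⁻¹ : ℝ) : ℂ) * ((‖T g‖ : ℂ)) ^ 2) = ‖T g‖ := by
    rw [← Complex.ofReal_pow, ← Complex.ofReal_mul]
    simp only [RCLike.re_to_complex, Complex.ofReal_re]
    field_simp
  have e' : RCLike.re (((‖T g‖⁻¹ : ℝ) : ℂ) * (((‖T g‖ : ℝ) : ℂ)) ^ 2) = ‖T g‖ := e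
  simp only [RCLike.re_to_complex, Complex.coe_algebraMap] at this e'
  rw [e'] at this
  linarith

/-- Schur multiplier bound for the kernels `m ^ (i + 1) s ^ (j + 1) / (m ^ 2 + s ^ 2) ^ 2`. -/
lemma norm_pow_mul_mul_pow_le {m s : H →L[ℂ] H} (hm : IsSelfAdjoint m) (hs : IsSelfAdjoint s)
    {a : ℝ} (ha0 : 0 < a) (ha : spectrum ℝ (m ^ 2) ⊆ Set.Ici a)
    (hb : spectrum ℝ (s ^ 2) ⊆ Set.Ici 0) (W : H →L[ℂ] H) {i j : ℕ} (hij : i + j = 2) :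
    ‖m ^ (i + 1) * W * s ^ (j + 1)‖ ≤
      (i.factorial / 2 ^ (i + 2) + j.factorial / 2 ^ (j + 2) : ℝ) *
        ‖sylvester (m ^ 2) (s ^ 2) (sylvester (m ^ 2) (s ^ 2) W)‖ := by
  set Y := sylvester (m ^ 2) (s ^ 2) (sylvester (m ^ 2) (s ^ 2) W) with hY
  rw [add_mul]
  refine opNorm_le_of_re_inner_le _ (by positivity) (by positivity) fun f g => ?_
  have hsym : ∀ u v : H, inner ℂ ((m ^ (i + 1)) u) v = inner ℂ u ((m ^ (i + 1)) v) :=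
    fun u v => (hm.pow (i + 1)).isSymmetric u v
  have e : inner ℂ f ((m ^ (i + 1) * W * s ^ (j + 1)) g) =
      inner ℂ ((m ^ (i + 1)) f) (W ((s ^ (j + 1)) g)) := by
    rw [hsym]; rfl
  rw [e]
  have key := re_inner_le_of_majorant (hm.pow 2) (hs.pow 2) ha0 ha hb ((m ^ (i + 1)) f)
    ((s ^ (j + 1)) g) W
    (fun t => (‖Y‖ / 2) * (energyPrimitive m f i t + energyPrimitive s g j t))
    (fun t => (‖Y‖ / 2) * (t ^ i * energy m f (i + 1) t + t ^ j * energy s g (j + 1) t))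
    (fun t ht => mul_nonneg (by positivity)
      (add_nonneg (energyPrimitive_nonneg hm f i ht) (energyPrimitive_nonneg hs g j ht)))
    (fun t => (((hasDerivAt_energyPrimitive hm f i t).add
      (hasDerivAt_energyPrimitive hs g j t)).const_mul _).congr_deriv (by ring))
    ?_
  · simp only [energyPrimitive_zero hm, energyPrimitive_zero hs] at key
    refine key.trans_eq ?_
    ring
  · intro t ht
    rw [energy_eq hm, energy_eq hs, ← hY]
    set x := decay (m ^ 2) t ((m ^ (i + 1)) f) with hx
    set y := decay (s ^ 2) t ((s ^ (j + 1)) g) with hy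
    have h1 : |form (m ^ 2) (s ^ 2) ((m ^ (i + 1)) f) ((s ^ (j + 1)) g) Y t| ≤
        ‖Y‖ * (‖x‖ * ‖y‖) := by
      refine ((RCLike.abs_re_le_norm _).trans (norm_inner_le_norm _ _)).trans ?_
      have := Y.le_opNorm y
      calc ‖x‖ * ‖Y y‖ ≤ ‖x‖ * (‖Y‖ * ‖y‖) := by gcongr
        _ = _ := by ring
    have h2 : 2 * (t * (‖x‖ * ‖y‖)) ≤ t ^ i * ‖x‖ ^ 2 + t ^ j * ‖y‖ ^ 2 := by
      have hi : i ≤ 2 := by omega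
      interval_cases i
      · obtain rfl : j = 2 := by omega
        nlinarith [sq_nonneg (‖x‖ - t * ‖y‖)]
      · obtain rfl : j = 1 := by omega
        nlinarith [mul_nonneg ht (sq_nonneg (‖x‖ - ‖y‖))]
      · obtain rfl : j = 0 := by omega
        nlinarith [sq_nonneg (t * ‖x‖ - ‖y‖)]
    calc t * |form (m ^ 2) (s ^ 2) ((m ^ (i + 1)) f) ((s ^ (j + 1)) g) Y t|
        ≤ t * (‖Y‖ * (‖x‖ * ‖y‖)) := by gcongr
      _ = (‖Y‖ / 2) * (2 * (t * (‖x‖ * ‖y‖))) := by ring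
      _ ≤ _ := by gcongr

lemma exists_sqrt {M : H →L[ℂ] H} (hM : IsSelfAdjoint M) (h0 : spectrum ℝ M ⊆ Set.Ici 0) :
    ∃ m : H →L[ℂ] H, IsSelfAdjoint m ∧ m ^ 2 = M ∧
      spectrum ℝ m = Real.sqrt '' spectrum ℝ M := by
  refine ⟨cfc Real.sqrt M, cfc_predicate _ _, ?_, cfc_map_spectrum Real.sqrt M⟩
  rw [← cfc_pow Real.sqrt 2 M]
  conv_rhs => rw [← cfc_id ℝ M]
  exact cfc_congr fun x hx => Real.sq_sqrt (h0 hx)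

lemma exists_resolvent {M : H →L[ℂ] H} (hM : IsSelfAdjoint M) {a r : ℝ} (har : 0 < a + r)
    (ha : spectrum ℝ M ⊆ Set.Ici a) :
    ∃ R : H →L[ℂ] H, R * (M + r • 1) = 1 ∧ (M + r • 1) * R = 1 ∧ ‖R‖ ≤ (a + r)⁻¹ := by
  have hne : ∀ x ∈ spectrum ℝ M, a + r ≤ x + r := fun x hx => by
    have := ha hx
    simp only [Set.mem_Ici] at this
    linarith
  have hc : ContinuousOn (fun x : ℝ => (x + r)⁻¹) (spectrum ℝ M) :=
    ContinuousOn.inv₀ (by fun_prop) fun x hx => (har.trans_le (hne x hx)).ne'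
  have hMr : M + r • 1 = cfc (fun x : ℝ => x + r) M := by
    rw [cfc_add_const r (fun x => x) M, cfc_id' ℝ M, Algebra.algebraMap_eq_smul_one]
  have hone : ∀ f : ℝ → ℝ, (∀ x ∈ spectrum ℝ M, f x = 1) → cfc f M = 1 := fun f hf => by
    rw [cfc_congr (g := fun _ => (1 : ℝ)) hf, cfc_const_one ℝ M]
  refine ⟨cfc (fun x : ℝ => (x + r)⁻¹) M, ?_, ?_, ?_⟩
  · rw [hMr, ← cfc_mul (fun x : ℝ => (x + r)⁻¹) (fun x : ℝ => x + r) M hc]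
    exact hone _ fun x hx => inv_mul_cancel₀ (har.trans_le (hne x hx)).ne'
  · rw [hMr, ← cfc_mul (fun x : ℝ => x + r) (fun x : ℝ => (x + r)⁻¹) M (by fun_prop) hc]
    exact hone _ fun x hx => mul_inv_cancel₀ (har.trans_le (hne x hx)).ne'
  · refine norm_cfc_le (inv_nonneg.2 har.le) fun x hx => ?_
    have h1 := har.trans_le (hne x hx)
    rw [Real.norm_eq_abs, abs_of_pos (inv_pos.2 h1)]
    exact inv_anti₀ har (hne x hx)

lemma norm_smul_one_sub_le {S : H →L[ℂ] H} (hS : IsSelfAdjoint S) {r : ℝ} (hr : 0 ≤ r)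
    (h : spectrum ℝ S ⊆ Set.Icc 0 r) : ‖r • 1 - S‖ ≤ r := by
  have : r • 1 - S = cfc (fun x : ℝ => r - x) S := by
    rw [cfc_sub (fun _ : ℝ => r) (fun x => x) S, cfc_id' ℝ S, cfc_const r S,
      Algebra.algebraMap_eq_smul_one]
  rw [this]
  refine norm_cfc_le hr fun x hx => ?_
  have := h hx
  rw [Real.norm_eq_abs, abs_of_nonneg (by linarith [this.2])]
  linarith [this.1]

lemma norm_le_of_spectrum_subset_Icc {S : H →L[ℂ] H} (hS : IsSelfAdjoint S) {r : ℝ} (hr : 0 ≤ r)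
    (h : spectrum ℝ S ⊆ Set.Icc 0 r) : ‖S‖ ≤ r := by
  rw [← cfc_id' ℝ S]
  refine norm_cfc_le hr fun x hx => ?_
  rw [Real.norm_eq_abs, abs_of_nonneg (h hx).1]
  exact (h hx).2

section Solve

variable {M S : H →L[ℂ] H} {a r : ℝ}

lemma sylvester_surjective (hM : IsSelfAdjoint M) (hS : IsSelfAdjoint S) (ha0 : 0 < a)
    (hr : 0 ≤ r) (ha : spectrum ℝ M ⊆ Set.Ici a) (hr' : spectrum ℝ S ⊆ Set.Icc 0 r) :
    Function.Surjective (sylvester M S) := by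
  intro Y
  obtain ⟨R, h1, h2, h3⟩ := exists_resolvent hM (r := r) (by linarith) ha
  have hn := norm_smul_one_sub_le hS hr hr'
  set Θ := mulLeftRight ℂ (H →L[ℂ] H) R (r • 1 - S) with hΘ
  have hΘn : ‖Θ‖ < 1 := by
    refine (opNorm_mulLeftRight_apply_apply_le ℂ (H →L[ℂ] H) R (r • 1 - S)).trans_lt ?_
    calc ‖R‖ * ‖r • 1 - S‖ ≤ (a + r)⁻¹ * r := by gcongr
      _ < 1 := by rw [inv_mul_lt_one₀ (by linarith)]; linarith
  obtain ⟨u, hu⟩ := isUnit_one_sub_of_norm_lt_one hΘn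
  refine ⟨(↑u⁻¹ : (H →L[ℂ] H) →L[ℂ] (H →L[ℂ] H)) (R * Y), ?_⟩
  set X := (↑u⁻¹ : (H →L[ℂ] H) →L[ℂ] (H →L[ℂ] H)) (R * Y) with hX
  have h4 : X - R * X * (r • 1 - S) = R * Y := by
    have h5 : (↑u * ↑u⁻¹ : (H →L[ℂ] H) →L[ℂ] (H →L[ℂ] H)) (R * Y) = R * Y := by simp
    rwa [hu, mul_apply_eq_comp, ← hX] at h5
  have h6 := congrArg (fun T => (M + r • 1) * T) h4
  simp only [mul_sub, ← mul_assoc, h2, one_mul] at h6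
  rw [← h6, sylvester]
  simp only [add_mul, smul_mul_assoc, one_mul, mul_smul_comm, mul_one]
  abel

lemma mul_norm_le_norm_sylvester (hM : IsSelfAdjoint M) (hS : IsSelfAdjoint S) (ha0 : 0 < a)
    (hr : 0 ≤ r) (ha : spectrum ℝ M ⊆ Set.Ici a) (hr' : spectrum ℝ S ⊆ Set.Icc 0 r)
    (X : H →L[ℂ] H) : a * ‖X‖ ≤ ‖sylvester M S X‖ := by
  obtain ⟨R, h1, h2, h3⟩ := exists_resolvent hM (r := r) (by linarith) ha
  have hn := norm_smul_one_sub_le hS hr hr'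
  have e : X = R * (sylvester M S X + X * (r • 1 - S)) := by
    have : sylvester M S X + X * (r • 1 - S) = (M + r • 1) * X := by
      simp [sylvester, mul_sub, add_mul]
    rw [this, ← mul_assoc, h1, one_mul]
  have h4 : ‖X‖ ≤ (a + r)⁻¹ * (‖sylvester M S X‖ + ‖X‖ * r) := by
    calc ‖X‖ = ‖R * (sylvester M S X + X * (r • 1 - S))‖ := by rw [← e]
      _ ≤ ‖R‖ * ‖sylvester M S X + X * (r • 1 - S)‖ := norm_mul_le _ _
      _ ≤ (a + r)⁻¹ * (‖sylvester M S X‖ + ‖X‖ * r) := by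
        gcongr
        refine (norm_add_le _ _).trans ?_
        gcongr
        exact (norm_mul_le _ _).trans (by gcongr)
  rw [inv_mul_eq_div, le_div_iff₀ (by linarith)] at h4
  linarith

end Solve

lemma norm_mul_le_step {m s : H →L[ℂ] H} (hm : IsSelfAdjoint m) (hs : IsSelfAdjoint s)
    {a r c : ℝ} (ha0 : 0 < a) (hr : 0 ≤ r) (ha : spectrum ℝ m ⊆ Set.Ici a)
    (hr' : spectrum ℝ s ⊆ Set.Icc 0 r) (hm2 : spectrum ℝ (m ^ 2) ⊆ Set.Ici (a ^ 2))
    (hs2 : spectrum ℝ (s ^ 2) ⊆ Set.Ici 0)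
    (hc : ∀ X, ‖X * s‖ ≤ c * ‖sylvester m s X‖) (X : H →L[ℂ] H) :
    ‖X * s ^ 2‖ ≤ (c + 9 / 8) * ‖sylvester (m ^ 2) (s ^ 2) X‖ := by
  obtain ⟨Z, rfl⟩ := sylvester_surjective hm hs ha0 hr ha hr' X
  obtain ⟨U, rfl⟩ := sylvester_surjective hm hs ha0 hr ha hr' Z
  obtain ⟨p, hp, rfl, -⟩ := exists_sqrt hm (ha.trans (Set.Ici_subset_Ici.2 ha0.le))
  obtain ⟨q, hq, rfl, -⟩ := exists_sqrt hs (hr'.trans Set.Icc_subset_Ici_self)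
  set m := p ^ 2
  set s := q ^ 2
  set N := sylvester (m ^ 2) (s ^ 2) (sylvester m s (sylvester m s U)) with hN
  set W := sylvester (m ^ 2) (s ^ 2) U with hW
  have hV := hc (sylvester (m ^ 2) (s ^ 2) (sylvester m s U))
  have e1 : sylvester m s (sylvester (m ^ 2) (s ^ 2) (sylvester m s U)) = N := by
    simp only [hN, sylvester]; noncomm_ring
  have e2 : sylvester m s (sylvester m s W) = N := by
    simp only [hN, hW, sylvester]; noncomm_ring
  have e3 : sylvester (m ^ 2) (s ^ 2) W = N - 2 • (m * W * s) := by
    simp only [hN, hW, sylvester]; noncomm_ring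
  have e4 : sylvester m s (sylvester m s U) * s ^ 2 =
      sylvester (m ^ 2) (s ^ 2) (sylvester m s U) * s +
        (m * U * s ^ 3 - m ^ 3 * U * s) := by
    simp only [sylvester]; noncomm_ring
  have k1 : ‖m * W * s‖ ≤ (1 / 4) * ‖N‖ := by
    have := norm_pow_mul_mul_pow_le hp hq ha0 ha (hr'.trans Set.Icc_subset_Ici_self) W
      (i := 1) (j := 1) rfl
    rw [show sylvester (p ^ 2) (q ^ 2) (sylvester (p ^ 2) (q ^ 2) W) = N from e2] at this
    norm_num at this
    linarith
  have k2 : ‖sylvester (m ^ 2) (s ^ 2) W‖ ≤ (3 / 2) * ‖N‖ := by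
    rw [e3]
    refine (norm_sub_le _ _).trans ?_
    have : ‖2 • (m * W * s)‖ ≤ 2 * ‖m * W * s‖ := by
      simpa using norm_nsmul_le (n := 2) (a := m * W * s)
    linarith
  have hk := fun i j hij => norm_pow_mul_mul_pow_le hm hs (by positivity) hm2 hs2 U
    (i := i) (j := j) hij
  have k3 : ‖m * U * s ^ 3‖ ≤ (3 / 8) * ‖sylvester (m ^ 2) (s ^ 2) W‖ := by
    have := hk 0 2 rfl
    norm_num at this
    exact this
  have k4 : ‖m ^ 3 * U * s‖ ≤ (3 / 8) * ‖sylvester (m ^ 2) (s ^ 2) W‖ := by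
    have := hk 2 0 rfl
    norm_num at this
    exact this
  rw [e4]
  rw [e1] at hV
  refine (norm_add_le _ _).trans ?_
  have := norm_sub_le (m * U * s ^ 3) (m ^ 3 * U * s)
  linarith

/-- Triangular-truncation type bound: the constant grows like `log (log (r / a))`. -/
lemma norm_mul_le_norm_sylvester (k : ℕ) : ∀ {M S : H →L[ℂ] H} {a r : ℝ}, IsSelfAdjoint M →
    IsSelfAdjoint S → 0 < a → 0 ≤ r → spectrum ℝ M ⊆ Set.Ici a →
    spectrum ℝ S ⊆ Set.Icc 0 r → r ≤ 2 ^ 2 ^ k * a →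
    ∀ X, ‖X * S‖ ≤ (2 + 9 / 8 * k) * ‖sylvester M S X‖ := by
  induction k with
  | zero =>
    intro M S a r hM hS ha0 hr ha hr' hk X
    have h1 := mul_norm_le_norm_sylvester hM hS ha0 hr ha hr' X
    have h2 := norm_le_of_spectrum_subset_Icc hS hr hr'
    have h3 : ‖X * S‖ ≤ ‖X‖ * r := (norm_mul_le _ _).trans (by gcongr)
    have h4 : ‖X‖ * r ≤ ‖X‖ * (2 * a) := by gcongr; simpa using hk
    simp only [Nat.cast_zero, mul_zero, add_zero]
    linarith
  | succ k ih =>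
    intro M S a r hM hS ha0 hr ha hr' hk X
    obtain ⟨m, hm, rfl, hm'⟩ := exists_sqrt hM (ha.trans (Set.Ici_subset_Ici.2 ha0.le))
    obtain ⟨s, hs, rfl, hs'⟩ := exists_sqrt hS (hr'.trans Set.Icc_subset_Ici_self)
    have h1 : spectrum ℝ m ⊆ Set.Ici (√a) := by
      rw [hm']
      rintro _ ⟨x, hx, rfl⟩
      exact Real.sqrt_le_sqrt (ha hx)
    have h2 : spectrum ℝ s ⊆ Set.Icc 0 (√r) := by
      rw [hs']
      rintro _ ⟨x, hx, rfl⟩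
      exact ⟨Real.sqrt_nonneg _, Real.sqrt_le_sqrt (hr' hx).2⟩
    have h3 : √r ≤ 2 ^ 2 ^ k * √a := by
      rw [Real.sqrt_le_left (by positivity), mul_pow, Real.sq_sqrt ha0.le, ← pow_mul, ← pow_succ]
      exact hk
    have := norm_mul_le_step hm hs (Real.sqrt_pos.2 ha0) (Real.sqrt_nonneg r) h1 h2
      (by rwa [Real.sq_sqrt ha0.le]) (hr'.trans Set.Icc_subset_Ici_self)
      (ih hm hs (Real.sqrt_pos.2 ha0) (Real.sqrt_nonneg r) h1 h2 h3) X
    refine this.trans_eq ?_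
    push_cast
    ring

end Kernel

section UpperBound

variable {H : Type} [NormedAddCommGroup H] [InnerProductSpace ℂ H] [CompleteSpace H]

lemma opAbs_eq_cfc_abs {A : H →L[ℂ] H} (hA : IsSelfAdjoint A) :
    opAbs A = cfc (fun x : ℝ => |x|) A := by
  have : star A * A = cfc (fun x : ℝ => x ^ 2) A := by
    rw [hA.star_eq, cfc_pow_id A 2, sq]
  rw [opAbs, this, ← cfc_comp' Real.sqrt (fun x : ℝ => x ^ 2) A]
  simp only [Real.sqrt_sq_eq_abs]

/-- The spectral projection onto the part of the spectrum above the gap, the positive part made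
invertible, and the negative part. -/
lemma exists_gap_decomposition {A : H →L[ℂ] H} (hA : IsSelfAdjoint A) {a b : ℝ} (ha : 0 < a)
    (hb : 0 < b) (h : spectrum ℝ A ⊆ Set.Ioc (-b) 0 ∪ Set.Ici a) :
    ∃ P M S : H →L[ℂ] H, IsSelfAdjoint P ∧ IsSelfAdjoint M ∧ IsSelfAdjoint S ∧
      M * P = P * A ∧ A * P = P * A ∧ S = A * P - A ∧ P * S = 0 ∧ ‖P‖ ≤ 1 ∧ ‖1 - P‖ ≤ 1 ∧
      spectrum ℝ M ⊆ Set.Ici a ∧ spectrum ℝ S ⊆ Set.Icc 0 b ∧ opAbs A = A + (2 : ℝ) • S := by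
  set p : ℝ → ℝ := fun x => min 1 (max 0 (x / a)) with hp
  set m : ℝ → ℝ := fun x => max x a with hm
  set n : ℝ → ℝ := fun x => max (-x) 0 with hn
  have hpc : Continuous p := by fun_prop
  have hmc : Continuous m := by fun_prop
  have hnc : Continuous n := by fun_prop
  have hcase : ∀ x ∈ spectrum ℝ A, (p x = 0 ∧ n x = -x ∧ -b < x ∧ x ≤ 0) ∨
      (p x = 1 ∧ n x = 0 ∧ m x = x ∧ a ≤ x) := by
    intro x hx
    rcases h hx with hx | hx
    · left
      have : x / a ≤ 0 := div_nonpos_of_nonpos_of_nonneg hx.2 ha.le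
      refine ⟨?_, ?_, hx.1, hx.2⟩
      · simp [hp, max_eq_left this]
      · exact max_eq_left (by linarith [hx.2])
    · right
      simp only [Set.mem_Ici] at hx
      have : 1 ≤ x / a := by rwa [one_le_div ha]
      refine ⟨?_, max_eq_right (by linarith), max_eq_left hx, hx⟩
      simp only [hp]
      rw [max_eq_right (by linarith), min_eq_left this]
  have hma : ∀ x, a ≤ m x := fun x => le_max_right _ _
  clear_value p m n
  have hpA : cfc p A * A = cfc (fun x => p x * x) A := by
    nth_rewrite 2 [← cfc_id' ℝ A]
    rw [← cfc_mul p (fun x => x) A]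
  have hAp : A * cfc p A = cfc (fun x => p x * x) A := by
    nth_rewrite 1 [← cfc_id' ℝ A]
    rw [← cfc_mul (fun x => x) p A]
    simp only [mul_comm]
  refine ⟨cfc p A, cfc m A, cfc n A, cfc_predicate _ _, cfc_predicate _ _, cfc_predicate _ _,
    ?_, ?_, ?_, ?_, ?_, ?_, ?_, ?_, ?_⟩
  · rw [hpA, ← cfc_mul m p A]
    refine cfc_congr fun x hx => ?_
    rcases hcase x hx with ⟨h1, -⟩ | ⟨h1, -, h2, -⟩
    · simp [h1]
    · simp [h1, h2]
  · rw [hpA, hAp]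
  · have : cfc (fun x => p x * x) A - A = cfc (fun x => p x * x - x) A := by
      rw [cfc_sub (fun x => p x * x) (fun x => x) A, cfc_id' ℝ A]
    rw [hAp, this]
    refine cfc_congr fun x hx => ?_
    rcases hcase x hx with ⟨h1, h2, -⟩ | ⟨h1, h2, -⟩ <;> simp [h1, h2]
  · rw [← cfc_mul p n A, ← cfc_zero ℝ A]
    refine cfc_congr fun x hx => ?_
    rcases hcase x hx with ⟨h1, -⟩ | ⟨-, h1, -⟩ <;> simp [h1]
  · refine norm_cfc_le zero_le_one fun x hx => ?_
    rcases hcase x hx with ⟨h1, -⟩ | ⟨h1, -⟩ <;> simp [h1]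
  · rw [← cfc_const_one ℝ A, ← cfc_sub (fun _ => (1 : ℝ)) p A]
    refine norm_cfc_le zero_le_one fun x hx => ?_
    rcases hcase x hx with ⟨h1, -⟩ | ⟨h1, -⟩ <;> simp [h1]
  · rw [cfc_map_spectrum m A]
    rintro _ ⟨x, -, rfl⟩
    exact hma x
  · rw [cfc_map_spectrum n A]
    rintro _ ⟨x, hx, rfl⟩
    rcases hcase x hx with ⟨-, h1, h2, h3⟩ | ⟨-, h1, -⟩
    · rw [h1]; constructor <;> linarith
    · rw [h1]; exact ⟨le_rfl, hb.le⟩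
  · have : A + (2 : ℝ) • cfc n A = cfc (fun x => x + 2 * n x) A := by
      rw [cfc_add A (fun x : ℝ => x) (fun x => 2 * n x), cfc_id' ℝ A, cfc_const_mul 2 n A]
    rw [opAbs_eq_cfc_abs hA, this]
    refine cfc_congr fun x hx => ?_
    rcases hcase x hx with ⟨-, h1, -, h2⟩ | ⟨-, h1, -, h2⟩
    · simp only [h1, abs_of_nonpos h2]; ring
    · simp only [h1, abs_of_nonneg (ha.le.trans h2)]; ring

lemma norm_opAbs_sub_le {A B : H →L[ℂ] H} (hA : IsSelfAdjoint A) (hB : IsSelfAdjoint B)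
    {a b : ℝ} (ha : 0 < a) (hb : 0 < b) (hAs : spectrum ℝ A ⊆ Set.Ioc (-b) 0 ∪ Set.Ici a)
    (hBs : spectrum ℝ B ⊆ Set.Ioc (-b) 0 ∪ Set.Ici a) {k : ℕ} (hk : b ≤ 2 ^ 2 ^ k * a) :
    ‖opAbs A - opAbs B‖ ≤ (11 + 9 / 2 * k) * ‖A - B‖ := by
  obtain ⟨P, M, S, hP, hM, hS, hMP, hAP, hSA, hPS, hPn, hPn', hMs, hSs, hAabs⟩ :=
    exists_gap_decomposition hA ha hb hAs
  obtain ⟨Q, N, T, hQ, hN, hT, hNQ, hBQ, hTB, hQT, hQn, hQn', hNs, hTs, hBabs⟩ :=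
    exists_gap_decomposition hB ha hb hBs
  have cross : ∀ {P M A Q T B : H →L[ℂ] H}, IsSelfAdjoint M → IsSelfAdjoint T →
      spectrum ℝ M ⊆ Set.Ici a → spectrum ℝ T ⊆ Set.Icc 0 b → M * P = P * A →
      T = B * Q - B → Q * T = 0 → ‖P‖ ≤ 1 → ‖1 - Q‖ ≤ 1 →
      ‖P * T‖ ≤ (2 + 9 / 8 * k) * ‖A - B‖ := by
    intro P M A Q T B hM hT hMs hTs hMP hTB hQT hPn hQn
    have h1 := norm_mul_le_norm_sylvester k hM hT ha hb.le hMs hTs hk (P * (1 - Q))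
    have e1 : P * (1 - Q) * T = P * T := by
      rw [mul_assoc, sub_mul, hQT, one_mul, sub_zero]
    have e2 : sylvester M T (P * (1 - Q)) = P * (A - B) * (1 - Q) := by
      rw [sylvester, e1, ← mul_assoc, hMP, hTB]
      noncomm_ring
    rw [e1, e2] at h1
    refine h1.trans ?_
    gcongr
    calc ‖P * (A - B) * (1 - Q)‖ ≤ ‖P‖ * ‖A - B‖ * ‖1 - Q‖ :=
          (norm_mul_le _ _).trans (by gcongr; exact norm_mul_le _ _)
      _ ≤ 1 * ‖A - B‖ * 1 := by gcongr
      _ = _ := by ring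
  have h1 := cross hM hT hMs hTs hMP hTB hQT hPn hQn'
  have h2 : ‖S * Q‖ ≤ (2 + 9 / 8 * k) * ‖A - B‖ := by
    have := cross hN hS hNs hSs hNQ hSA hPS hQn hPn'
    rw [← norm_star, star_mul, hQ.star_eq, hS.star_eq, norm_sub_rev] at this
    exact this
  have h3 : ‖(1 - P) * (A - B) * (1 - Q)‖ ≤ ‖A - B‖ :=
    calc ‖(1 - P) * (A - B) * (1 - Q)‖ ≤ ‖1 - P‖ * ‖A - B‖ * ‖1 - Q‖ :=
          (norm_mul_le _ _).trans (by gcongr; exact norm_mul_le _ _)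
      _ ≤ 1 * ‖A - B‖ * 1 := by gcongr
      _ = _ := by ring
  have e : S - T = S * Q - P * T - (1 - P) * (A - B) * (1 - Q) := by
    have e1 : (1 - P) * A = -S := by rw [hSA, hAP]; noncomm_ring
    have e2 : B * (1 - Q) = -T := by rw [hTB]; noncomm_ring
    rw [mul_sub (1 - P) A B, sub_mul, e1, mul_assoc (1 - P) B, e2]
    noncomm_ring
  have h4 : ‖S - T‖ ≤ (5 + 9 / 4 * k) * ‖A - B‖ := by
    rw [e]
    refine (norm_sub_le _ _).trans ?_
    have := norm_sub_le (S * Q) (P * T)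
    linarith
  have e' : opAbs A - opAbs B = (A - B) + (2 : ℝ) • (S - T) := by
    rw [hAabs, hBabs, smul_sub]; abel
  rw [e']
  refine (norm_add_le _ _).trans ?_
  rw [norm_smul, Real.norm_eq_abs, abs_two]
  linarith

lemma exists_nat_pow_pow_mul_ge {a b : ℝ} (ha : 0 < a) (hb : 0 < b) :
    ∃ k : ℕ, b ≤ 2 ^ 2 ^ k * a ∧
      11 + 9 / 2 * (k : ℝ) ≤ 49 * Real.log (2 + max (Real.log (b / a)) 0) := by
  set L := max (Real.log (b / a)) 0 with hL
  have hL0 : 0 ≤ L := le_max_right _ _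
  have hl2 : (1 / 2 : ℝ) ≤ Real.log 2 := by linarith [Real.log_two_gt_d9]
  have hℓ : Real.log 2 ≤ Real.log (2 + L) := Real.log_le_log (by norm_num) (by linarith)
  refine ⟨⌈Real.log (2 + 2 * L) / Real.log 2⌉₊, ?_, ?_⟩
  · set k := ⌈Real.log (2 + 2 * L) / Real.log 2⌉₊
    have h1 : Real.log (2 + 2 * L) / Real.log 2 ≤ k := Nat.le_ceil _
    rw [div_le_iff₀ (by linarith), ← Real.log_pow] at h1
    have h2 : 2 + 2 * L ≤ 2 ^ k := (Real.log_le_log_iff (by linarith) (by positivity)).1 h1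
    have h3 : Real.log (b / a) ≤ Real.log (2 ^ 2 ^ k) := by
      rw [Real.log_pow]
      push_cast
      have : Real.log (b / a) ≤ L := le_max_left _ _
      nlinarith
    have h4 := (Real.log_le_log_iff (by positivity) (by positivity)).1 h3
    rwa [div_le_iff₀ ha] at h4
  · have h1 : (⌈Real.log (2 + 2 * L) / Real.log 2⌉₊ : ℝ) < Real.log (2 + 2 * L) / Real.log 2 + 1 :=
      Nat.ceil_lt_add_one (div_nonneg (Real.log_nonneg (by linarith)) (by linarith))
    have h2 : Real.log (2 + 2 * L) ≤ 2 * Real.log (2 + L) := by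
      rw [show 2 + 2 * L = 2 * (1 + L) by ring, Real.log_mul (by norm_num) (by linarith)]
      have : Real.log (1 + L) ≤ Real.log (2 + L) := Real.log_le_log (by linarith) (by linarith)
      linarith
    have h3 : Real.log (2 + 2 * L) / Real.log 2 ≤ 4 * Real.log (2 + L) := by
      rw [div_le_iff₀ (by linarith)]
      nlinarith
    linarith

end UpperBound

section Hilbert

open scoped Matrix.Norms.L2Operator
open Matrix

lemma sum_inv_sub_sq_le (N i : ℕ) (hi : i < N) :
    ∑ k ∈ Finset.range N, (((i : ℝ) - k)⁻¹) ^ 2 ≤ 4 := by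
  set t : ℕ → ℝ := fun k => ((k : ℝ) - i - 1 / 2)⁻¹ with ht
  have h1 : ∀ k ∈ Finset.range N, (((i : ℝ) - k)⁻¹) ^ 2 ≤
      (t k - t (k + 1)) + if k = i then 4 else 0 := by
    intro k _
    simp only [ht]
    push_cast
    rcases eq_or_ne k i with rfl | hk
    · norm_num
    · rw [if_neg hk, add_zero]
      obtain ⟨d, hd⟩ : ∃ d : ℝ, d = (k : ℝ) - i := ⟨_, rfl⟩
      have hd1 : 1 ≤ d ^ 2 := by
        have : (1 : ℤ) ≤ ((k : ℤ) - i) ^ 2 := by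
          have : (k : ℤ) - i ≠ 0 := by omega
          have := sq_pos_of_ne_zero this
          omega
        rw [hd]
        exact_mod_cast this
      have e : (i : ℝ) - k = -d := by rw [hd]; ring
      rw [e, ← hd, show (k : ℝ) + 1 - i - 1 / 2 = d + 1 / 2 by rw [hd]; ring]
      have h2 : d - 1 / 2 ≠ 0 := fun h => by nlinarith
      have h3 : d + 1 / 2 ≠ 0 := fun h => by nlinarith
      rw [inv_sub_inv h2 h3, inv_neg, neg_sq, inv_pow, inv_eq_one_div, div_le_div_iff₀]
      · nlinarith
      · positivity
      · nlinarith
  refine (Finset.sum_le_sum h1).trans ?_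
  rw [Finset.sum_add_distrib, Finset.sum_range_sub', Finset.sum_ite_eq',
    if_pos (Finset.mem_range.2 hi)]
  have h2 : t 0 ≤ 0 := by
    simp only [ht]
    rw [inv_nonpos]
    push_cast
    have : (0 : ℝ) ≤ i := by positivity
    linarith
  have h3 : 0 ≤ t N := by
    simp only [ht]
    rw [inv_nonneg]
    have : (i : ℝ) + 1 ≤ N := by exact_mod_cast hi
    linarith
  linarith

/-- The real antisymmetric Hilbert matrix with entries `1 / (i - j)`, zero on the diagonal. -/
noncomputable def hilbertMatrix (N : ℕ) : Matrix (Fin N) (Fin N) ℂ :=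
  Matrix.of fun i j => ((((i : ℝ) - (j : ℝ))⁻¹ : ℝ) : ℂ)

lemma conjTranspose_hilbertMatrix (N : ℕ) : (hilbertMatrix N)ᴴ = -hilbertMatrix N := by
  ext i j
  simp only [hilbertMatrix, conjTranspose_apply, of_apply, Matrix.neg_apply, ← starRingEnd_apply,
    Complex.conj_ofReal]
  rw [← Complex.ofReal_neg, ← inv_neg, neg_sub]

lemma inv_mul_inv_sub (x y z : ℝ) (hxy : x ≠ y) :
    (x - z)⁻¹ * (z - y)⁻¹ = (x - y)⁻¹ * ((x - z)⁻¹ - (y - z)⁻¹) -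
      ((if z = x then ((x - y)⁻¹) ^ 2 else 0) + if z = y then ((x - y)⁻¹) ^ 2 else 0) := by
  have h : x - y ≠ 0 := sub_ne_zero.2 hxy
  rcases eq_or_ne z x with rfl | hx
  · rw [if_pos rfl, if_neg hxy, sub_self, ← neg_sub z y, inv_neg]
    generalize (z - y)⁻¹ = w
    rw [_root_.inv_zero]
    ring
  rcases eq_or_ne z y with rfl | hy
  · rw [if_pos rfl, if_neg hx, sub_self]
    generalize (x - z)⁻¹ = w
    rw [_root_.inv_zero]
    ring
  · rw [if_neg hx, if_neg hy]
    have h1 : x - z ≠ 0 := sub_ne_zero.2 hx.symm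
    have h2 : z - y ≠ 0 := sub_ne_zero.2 hy
    have h3 : y - z ≠ 0 := sub_ne_zero.2 hy.symm
    field_simp
    ring

lemma sum_inv_mul_inv (N : ℕ) (i j : Fin N) :
    ∑ k : Fin N, ((i : ℝ) - (k : ℝ))⁻¹ * ((k : ℝ) - (j : ℝ))⁻¹ =
      (∑ k : Fin N, ((i : ℝ) - (k : ℝ))⁻¹) * ((i : ℝ) - (j : ℝ))⁻¹ -
      ((i : ℝ) - (j : ℝ))⁻¹ * (∑ k : Fin N, ((j : ℝ) - (k : ℝ))⁻¹) -
      (2 * (((i : ℝ) - (j : ℝ))⁻¹) ^ 2 +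
        if i = j then ∑ k : Fin N, (((i : ℝ) - (k : ℝ))⁻¹) ^ 2 else 0) := by
  rcases eq_or_ne i j with rfl | hij
  · simp only [sub_self, _root_.inv_zero, mul_zero, if_true, zero_mul]
    rw [zero_sub, eq_neg_iff_add_eq_zero, zero_pow two_ne_zero, mul_zero, zero_add,
      ← Finset.sum_add_distrib]
    refine Finset.sum_eq_zero fun k _ => ?_
    rw [← neg_sub (i : ℝ) k, inv_neg]
    ring
  · have hne : ((i : ℕ) : ℝ) ≠ ((j : ℕ) : ℝ) := by
      simpa [Fin.ext_iff] using hij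
    rw [if_neg hij, Finset.sum_congr rfl fun k _ => inv_mul_inv_sub _ _ _ hne,
      Finset.sum_sub_distrib, ← Finset.mul_sum, Finset.sum_sub_distrib, Finset.sum_add_distrib]
    have e : ∀ l : Fin N, ∑ k : Fin N, (if ((k : ℕ) : ℝ) = ((l : ℕ) : ℝ) then
        ((((i : ℕ) : ℝ) - ((j : ℕ) : ℝ))⁻¹) ^ 2 else 0) =
          ((((i : ℕ) : ℝ) - ((j : ℕ) : ℝ))⁻¹) ^ 2 := by
      intro l
      simp [Fin.val_inj]
    rw [e, e]
    ring

lemma hilbertMatrix_mul_self (N : ℕ) :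
    hilbertMatrix N * hilbertMatrix N =
      Matrix.diagonal (fun i : Fin N => ((∑ k : Fin N, ((i : ℝ) - (k : ℝ))⁻¹ : ℝ) : ℂ)) *
        hilbertMatrix N -
      hilbertMatrix N *
        Matrix.diagonal (fun i : Fin N => ((∑ k : Fin N, ((i : ℝ) - (k : ℝ))⁻¹ : ℝ) : ℂ)) -
      Matrix.of fun i j : Fin N => (((2 * (((i : ℝ) - (j : ℝ))⁻¹) ^ 2 +
        if i = j then ∑ k : Fin N, (((i : ℝ) - (k : ℝ))⁻¹) ^ 2 else 0) : ℝ) : ℂ) := by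
  ext i j
  rw [Matrix.sub_apply, Matrix.sub_apply, diagonal_mul, mul_diagonal, Matrix.mul_apply]
  simp only [hilbertMatrix, of_apply, ← Complex.ofReal_mul, ← Complex.ofReal_sum,
    ← Complex.ofReal_sub]
  rw [sum_inv_mul_inv]

/-- Schur's test for a symmetric kernel. -/
lemma sum_sum_mul_le {ι : Type*} [Fintype ι] (r : ι → ι → ℝ) (hr : ∀ i j, 0 ≤ r i j)
    (hsym : ∀ i j, r i j = r j i) {C : ℝ} (hC : ∀ i, ∑ j, r i j ≤ C) (x : ι → ℝ) :
    ∑ i, ∑ j, r i j * (x i * x j) ≤ C * ∑ i, x i ^ 2 := by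
  have h1 : ∑ i, ∑ j, r i j * (x i * x j) ≤
      ∑ i, ∑ j, (r i j * x i ^ 2 / 2 + r i j * x j ^ 2 / 2) := by
    refine Finset.sum_le_sum fun i _ => Finset.sum_le_sum fun j _ => ?_
    nlinarith [mul_nonneg (hr i j) (sq_nonneg (x i - x j))]
  have h2 : ∑ i, ∑ j, r i j * x j ^ 2 / 2 = ∑ i, ∑ j, r i j * x i ^ 2 / 2 := by
    rw [Finset.sum_comm]
    exact Finset.sum_congr rfl fun i _ => Finset.sum_congr rfl fun j _ => by rw [hsym]
  simp only [Finset.sum_add_distrib] at h1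
  rw [h2, ← two_mul, Finset.mul_sum] at h1
  refine h1.trans ?_
  rw [Finset.mul_sum]
  refine Finset.sum_le_sum fun i _ => ?_
  have : 2 * ∑ j, r i j * x i ^ 2 / 2 = (∑ j, r i j) * x i ^ 2 := by
    rw [Finset.mul_sum, Finset.sum_mul]
    exact Finset.sum_congr rfl fun j _ => by ring
  rw [this]
  gcongr
  exact hC i

lemma norm_hilbertMatrix_le (N : ℕ) : ‖hilbertMatrix N‖ ≤ 4 := by
  set T : Matrix (Fin N) (Fin N) ℂ := Complex.I • hilbertMatrix N with hT
  have hTs : IsSelfAdjoint T := by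
    rw [IsSelfAdjoint, hT, star_smul, star_eq_conjTranspose, conjTranspose_hilbertMatrix]
    simp
  have hn : ‖hilbertMatrix N‖ = ‖T‖ := by rw [hT, norm_smul, Complex.norm_I, one_mul]
  rw [hn, ← cfc_id' ℝ T]
  refine norm_cfc_le (by norm_num) fun x hx => ?_
  have hdet : (algebraMap ℝ (Matrix (Fin N) (Fin N) ℂ) x - T).det = 0 := by
    by_contra h
    exact hx ((Matrix.isUnit_iff_isUnit_det _).2 (isUnit_iff_ne_zero.2 h))
  obtain ⟨v, hv0, hv⟩ := Matrix.exists_mulVec_eq_zero_iff.2 hdet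
  set lam : ℂ := -Complex.I * x with hlam
  have hv1 : hilbertMatrix N *ᵥ v = lam • v := by
    have h1 : Complex.I • (hilbertMatrix N *ᵥ v) = (x : ℂ) • v := by
      rw [sub_mulVec, sub_eq_zero, hT, smul_mulVec] at hv
      rw [← hv, Algebra.algebraMap_eq_smul_one, smul_mulVec, one_mulVec]
      ext i
      simp
    have h2 := congrArg (fun w => (-Complex.I) • w) h1
    simp only [smul_smul, neg_mul, Complex.I_mul_I, neg_neg, one_smul] at h2
    rw [h2, hlam, neg_mul]
  have hv2 : star v ᵥ* hilbertMatrix N = lam • star v := by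
    have : hilbertMatrix N = -(hilbertMatrix N)ᴴ := by rw [conjTranspose_hilbertMatrix, neg_neg]
    rw [this, vecMul_neg, ← star_mulVec, hv1, star_smul, ← neg_smul]
    congr 1
    simp [hlam]
  have key := congrArg (fun M => star v ⬝ᵥ (M *ᵥ v)) (hilbertMatrix_mul_self N)
  simp only [sub_mulVec, dotProduct_sub, ← mulVec_mulVec] at key
  simp only [dotProduct_mulVec (star v) (hilbertMatrix N), hv1, hv2, mulVec_smul, dotProduct_smul,
    smul_dotProduct, sub_self, zero_sub] at key
  set r : Fin N → Fin N → ℝ := fun i j => 2 * (((i : ℝ) - (j : ℝ))⁻¹) ^ 2 +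
        if i = j then ∑ k : Fin N, (((i : ℝ) - (k : ℝ))⁻¹) ^ 2 else 0 with hr
  have hvv : star v ⬝ᵥ v = ((∑ i, ‖v i‖ ^ 2 : ℝ) : ℂ) := by
    simp only [dotProduct, Pi.star_apply]
    push_cast
    exact Finset.sum_congr rfl fun i _ => by
      rw [← Complex.conj_mul']; rfl
  have hpos : 0 < ∑ i, ‖v i‖ ^ 2 := by
    obtain ⟨i, hi⟩ := Function.ne_iff.1 hv0
    have : 0 < ‖v i‖ := norm_pos_iff.2 hi
    exact Finset.sum_pos' (fun j _ => by positivity) ⟨i, Finset.mem_univ _, by positivity⟩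
  have hbound : ‖star v ⬝ᵥ (Matrix.of fun i j => ((r i j : ℝ) : ℂ)) *ᵥ v‖ ≤
      12 * ∑ i, ‖v i‖ ^ 2 := by
    have hr0 : ∀ i j, 0 ≤ r i j := fun i j => by
      simp only [hr]
      have : 0 ≤ ∑ k : Fin N, (((i : ℝ) - (k : ℝ))⁻¹) ^ 2 := Finset.sum_nonneg fun _ _ => sq_nonneg _
      split_ifs <;> positivity
    have hrow : ∀ i : Fin N, ∑ k : Fin N, (((i : ℝ) - (k : ℝ))⁻¹) ^ 2 ≤ 4 := fun i => by
      rw [Fin.sum_univ_eq_sum_range (fun k => (((i : ℝ) - (k : ℝ))⁻¹) ^ 2) N]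
      exact sum_inv_sub_sq_le N i i.2
    refine le_trans ?_ (sum_sum_mul_le r hr0 ?_ (C := 12) ?_ (fun i => ‖v i‖))
    · simp only [dotProduct, mulVec, of_apply]
      refine (norm_sum_le _ _).trans (Finset.sum_le_sum fun i _ => ?_)
      rw [norm_mul, Pi.star_apply, norm_star]
      calc ‖v i‖ * ‖∑ j, (r i j : ℂ) * v j‖ ≤ ‖v i‖ * ∑ j, r i j * ‖v j‖ := by
            gcongr
            refine (norm_sum_le _ _).trans (Finset.sum_le_sum fun j _ => ?_)
            rw [norm_mul, Complex.norm_real, Real.norm_eq_abs, abs_of_nonneg (hr0 i j)]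
        _ = ∑ j, r i j * (‖v i‖ * ‖v j‖) := by
            rw [Finset.mul_sum]
            exact Finset.sum_congr rfl fun j _ => by ring
    · intro i j
      simp only [hr]
      rcases eq_or_ne i j with rfl | hij
      · rfl
      · rw [if_neg hij, if_neg hij.symm, ← neg_sub, inv_neg, neg_sq]
    · intro i
      simp only [hr, Finset.sum_add_distrib, ← Finset.mul_sum, Finset.sum_ite_eq, Finset.mem_univ,
        if_true]
      linarith [hrow i]
  have h5 : x ^ 2 * ∑ i, ‖v i‖ ^ 2 ≤ 12 * ∑ i, ‖v i‖ ^ 2 := by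
    have h6 := congrArg norm key
    rw [norm_neg] at h6
    rw [← h6, hvv] at hbound
    refine le_trans (le_of_eq ?_) hbound
    simp only [smul_eq_mul, norm_mul, Complex.norm_real, hlam, norm_neg, Complex.norm_I, one_mul,
      Real.norm_eq_abs]
    rw [abs_of_pos hpos, ← mul_assoc, abs_mul_abs_self, sq]
  have h6 : x ^ 2 ≤ 12 := le_of_mul_le_mul_right h5 hpos
  rw [Real.norm_eq_abs]
  exact abs_le_of_sq_le_sq (by linarith) (by norm_num)

end Hilbert

section Cayley

variable {R : Type*} [NormedRing R] [NormedAlgebra ℂ R] [StarRing R] [CStarRing R]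
  [StarModule ℂ R] [CompleteSpace R] [Nontrivial R]

/-- Conjugating by the Cayley transform of a small multiple of `K` displaces every element by an
amount comparable to its commutator with `K`. -/
lemma exists_unitary_norm_sub_conj {K : R} (hK : IsSelfAdjoint K) :
    ∃ U ∈ unitary R, ∃ t : ℝ, 0 < t ∧ ∀ D : R,
      ‖D - U * D * star U‖ ≤ 8 * t * ‖D * K - K * D‖ ∧
      8 / 9 * t * ‖D * K - K * D‖ ≤ ‖D - U * D * star U‖ := by
  set t : ℝ := 1 / (2 * (‖K‖ + 1)) with ht
  have htpos : 0 < t := by positivity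
  set T : R := (Complex.I * t) • K with hT
  have hTstar : star T = -T := by
    rw [hT, star_smul, hK.star_eq, ← neg_smul]
    simp
  have hTnorm : ‖T‖ ≤ 1 / 2 := by
    rw [hT, norm_smul, norm_mul, Complex.norm_I, one_mul, Complex.norm_real, Real.norm_eq_abs,
      abs_of_pos htpos, ht, div_mul_eq_mul_div, div_le_div_iff₀ (by positivity) two_pos]
    linarith [norm_nonneg K]
  obtain ⟨u, hu⟩ := isUnit_one_sub_of_norm_lt_one (lt_of_le_of_lt hTnorm (by norm_num))
  obtain ⟨S, hS⟩ : ∃ S : R, S = ((u⁻¹ : Rˣ) : R) := ⟨_, rfl⟩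
  have h1 : (1 - T) * S = 1 := by rw [← hu, hS, Units.mul_inv]
  have h2 : S * (1 - T) = 1 := by rw [← hu, hS, Units.inv_mul]
  have h3 : star S * (1 + T) = 1 := by
    have := congrArg star h1
    rwa [star_mul, star_sub, star_one, hTstar, sub_neg_eq_add] at this
  have h4 : (1 + T) * star S = 1 := by
    have := congrArg star h2
    rwa [star_mul, star_sub, star_one, hTstar, sub_neg_eq_add] at this
  have hS2 : ‖S‖ ≤ 2 := by
    have e : S = 1 + T * S := by
      rw [sub_mul, one_mul, sub_eq_iff_eq_add] at h1
      exact h1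
    have := norm_add_le (1 : R) (T * S)
    rw [← e, CStarRing.norm_one] at this
    have := norm_mul_le T S
    nlinarith [norm_nonneg S]
  have hcomm : (1 + T) * S = S * (1 + T) := by
    have e : (1 + T) = 2 - (1 - T) := by rw [← one_add_one_eq_two]; abel
    rw [e, sub_mul, mul_sub, h1, h2, two_mul, mul_two]
  set U : R := (1 + T) * S with hU
  have hUstar : star U = star S * (1 - T) := by
    rw [hU, star_mul, star_add, star_one, hTstar, ← sub_eq_add_neg]
  have hUS : U = S + S - 1 := by
    have e : (1 + T) = 2 - (1 - T) := by rw [← one_add_one_eq_two]; abel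
    rw [hU, e, sub_mul, h1, two_mul]
  have hUmem : U ∈ unitary R := by
    rw [Unitary.mem_iff]
    constructor
    · rw [hUstar, hU]
      calc star S * (1 - T) * ((1 + T) * S) = star S * (1 + T) * ((1 - T) * S) := by noncomm_ring
        _ = 1 := by rw [h1, h3, one_mul]
    · rw [hUstar, hcomm]
      calc S * (1 + T) * (star S * (1 - T)) = S * ((1 + T) * star S) * (1 - T) := by noncomm_ring
        _ = 1 := by rw [h4, mul_one, h2]
  refine ⟨U, hUmem, t, htpos, fun D => ?_⟩
  set c : R := D * S - S * D with hc
  have hnorm : ‖D - U * D * star U‖ = 2 * ‖c‖ := by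
    have e : (D - U * D * star U) * U = (2 : ℂ) • c := by
      rw [sub_mul, mul_assoc _ (star U), (Unitary.mem_iff.1 hUmem).1, mul_one, hUS, hc, two_smul]
      noncomm_ring
    rw [← CStarRing.norm_mul_mem_unitary _ hUmem, e, norm_smul]
    norm_num
  have hDT : ‖D * T - T * D‖ = t * ‖D * K - K * D‖ := by
    rw [hT, mul_smul_comm, smul_mul_assoc, ← smul_sub, norm_smul, norm_mul, Complex.norm_I,
      one_mul, Complex.norm_real, Real.norm_eq_abs, abs_of_pos htpos]
  have e1 : c = S * (D * T - T * D) * S := by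
    calc c = S * (1 - T) * (D * S) - S * D * ((1 - T) * S) := by rw [h1, h2, one_mul, mul_one]
      _ = S * (D * T - T * D) * S := by noncomm_ring
  have e2 : D * T - T * D = (1 - T) * c * (1 - T) := by
    calc D * T - T * D = (1 - T) * D - D * (1 - T) := by noncomm_ring
      _ = (1 - T) * D * (S * (1 - T)) - (1 - T) * S * (D * (1 - T)) := by
        rw [h1, h2, one_mul, mul_one]
      _ = (1 - T) * c * (1 - T) := by rw [hc]; noncomm_ring
  have h1T : ‖1 - T‖ ≤ 3 / 2 := by
    refine (norm_sub_le _ _).trans ?_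
    rw [CStarRing.norm_one]
    linarith
  have n1 : ‖c‖ ≤ 4 * ‖D * T - T * D‖ := by
    conv_lhs => rw [e1]
    refine (norm_mul₃_le).trans ?_
    have : ‖S‖ * ‖S‖ ≤ 2 * 2 := mul_le_mul hS2 hS2 (norm_nonneg _) (by norm_num)
    nlinarith [norm_nonneg (D * T - T * D)]
  have n2 : ‖D * T - T * D‖ ≤ 9 / 4 * ‖c‖ := by
    rw [e2]
    refine (norm_mul₃_le).trans ?_
    have : ‖1 - T‖ * ‖1 - T‖ ≤ 3 / 2 * (3 / 2) :=
      mul_le_mul h1T h1T (norm_nonneg _) (by norm_num)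
    nlinarith [norm_nonneg c]
  rw [hDT] at n1 n2
  rw [hnorm]
  constructor <;> linarith

end Cayley

section Lacunary

open scoped Matrix.Norms.L2Operator
open Matrix

/-- The alternating geometric sequence `(-1) ^ i * (a * 3 ^ i)`. -/
def alternatingSeq (a : ℝ) (i : ℕ) : ℝ := (-1) ^ i * (a * 3 ^ i)

/-- The kernel obtained from the Hilbert matrix by keeping the entries that join indices of
opposite parity and dividing by the difference of the corresponding terms of
`alternatingSeq a`. -/
noncomputable def alternatingKernel (a : ℝ) (i j : ℕ) : ℝ :=
  (1 - (-1) ^ i * (-1) ^ j) / 2 * (((i : ℝ) - j)⁻¹ * (alternatingSeq a i - alternatingSeq a j)⁻¹)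

lemma abs_alternatingSeq {a : ℝ} (ha : 0 < a) (i : ℕ) : |alternatingSeq a i| = a * 3 ^ i := by
  rw [alternatingSeq, abs_mul, abs_pow, abs_neg, abs_one, one_pow, one_mul,
    abs_of_pos (by positivity)]

lemma alternatingKernel_comm (a : ℝ) (i j : ℕ) :
    alternatingKernel a i j = alternatingKernel a j i := by
  rw [alternatingKernel, alternatingKernel, ← neg_sub (i : ℝ) j, inv_neg,
    ← neg_sub (alternatingSeq a i), inv_neg, mul_comm ((-1 : ℝ) ^ j), neg_mul_neg]

lemma neg_one_pow_eq_or_eq_neg (i j : ℕ) :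
    ((-1 : ℝ) ^ j = (-1) ^ i) ∨ ((-1 : ℝ) ^ j = -(-1) ^ i) := by
  rcases neg_one_pow_eq_or ℝ i with h | h <;> rcases neg_one_pow_eq_or ℝ j with h' | h' <;>
    simp [h, h']

lemma neg_one_pow_mul_self (i : ℕ) : (-1 : ℝ) ^ i * (-1) ^ i = 1 := by
  rw [← mul_pow]; simp

lemma sub_mul_alternatingKernel {a : ℝ} (ha : 0 < a) (i j : ℕ) :
    (alternatingSeq a i - alternatingSeq a j) * alternatingKernel a i j =
      (1 - (-1) ^ i * (-1) ^ j) / 2 * ((i : ℝ) - j)⁻¹ := by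
  rcases neg_one_pow_eq_or_eq_neg i j with h | h
  · rw [alternatingKernel, h, neg_one_pow_mul_self]
    simp
  · have hne : alternatingSeq a i - alternatingSeq a j ≠ 0 := by
      rw [alternatingSeq, alternatingSeq, h, neg_mul, sub_neg_eq_add, ← mul_add]
      have : (-1 : ℝ) ^ i ≠ 0 := pow_ne_zero _ (by norm_num)
      positivity
    rw [alternatingKernel]
    field_simp

lemma neg_one_pow_mul_abs_sub_mul {a : ℝ} (ha : 0 < a) {i j : ℕ}
    (h : (-1 : ℝ) ^ j = -(-1) ^ i) :
    (-1) ^ i * ((|alternatingSeq a i| - |alternatingSeq a j|) * alternatingKernel a i j) =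
      ((3 : ℝ) ^ j - 3 ^ i) / (3 ^ j + 3 ^ i) * ((j : ℝ) - i)⁻¹ := by
  rw [abs_alternatingSeq ha, abs_alternatingSeq ha, alternatingKernel, alternatingSeq,
    alternatingSeq, h, mul_neg, neg_one_pow_mul_self, neg_mul, sub_neg_eq_add, sub_neg_eq_add,
    ← mul_add, ← mul_add, ← mul_sub, ← neg_sub (j : ℝ), inv_neg]
  generalize ((j : ℝ) - i)⁻¹ = w
  have h1 : ((-1 : ℝ) ^ i)⁻¹ = (-1) ^ i := by
    rw [inv_eq_iff_eq_inv]
    exact eq_inv_of_mul_eq_one_left (neg_one_pow_mul_self i)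
  rw [mul_inv, mul_inv, h1]
  have h2 : (3 : ℝ) ^ j + 3 ^ i ≠ 0 := by positivity
  have h3 : (3 : ℝ) ^ i + 3 ^ j ≠ 0 := by positivity
  have e : (-1 : ℝ) ^ i * (a * (3 ^ i - 3 ^ j) * ((1 + 1) / 2 * (-w * ((-1) ^ i *
      (a⁻¹ * (3 ^ i + 3 ^ j)⁻¹))))) = ((-1 : ℝ) ^ i * (-1) ^ i) * (a * a⁻¹) *
        ((3 ^ j - 3 ^ i) * w * (3 ^ i + 3 ^ j)⁻¹) := by ring
  rw [e, neg_one_pow_mul_self, mul_inv_cancel₀ ha.ne', add_comm]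
  ring

lemma neg_one_pow_mul_abs_sub_mul_nonneg {a : ℝ} (ha : 0 < a) (i j : ℕ) :
    0 ≤ (-1) ^ i * ((|alternatingSeq a i| - |alternatingSeq a j|) * alternatingKernel a i j) := by
  rcases neg_one_pow_eq_or_eq_neg i j with h | h
  · rw [alternatingKernel, h, neg_one_pow_mul_self]
    simp
  · rw [neg_one_pow_mul_abs_sub_mul ha h]
    rcases le_total i j with hij | hij
    · have h1 : (3 : ℝ) ^ i ≤ 3 ^ j := pow_le_pow_right₀ (by norm_num) hij
      have h2 : (i : ℝ) ≤ j := by exact_mod_cast hij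
      exact mul_nonneg (div_nonneg (by linarith) (by positivity))
        (inv_nonneg.2 (by linarith))
    · have h1 : (3 : ℝ) ^ j ≤ 3 ^ i := pow_le_pow_right₀ (by norm_num) hij
      have h2 : (j : ℝ) ≤ i := by exact_mod_cast hij
      exact mul_nonneg_of_nonpos_of_nonpos
        (div_nonpos_of_nonpos_of_nonneg (by linarith) (by positivity))
        (inv_nonpos.2 (by linarith))

lemma le_neg_one_pow_mul_abs_sub_mul {a : ℝ} (ha : 0 < a) (i l : ℕ) :
    1 / 4 * ((l + 1 : ℕ) : ℝ)⁻¹ ≤ (-1) ^ i * ((|alternatingSeq a i| -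
      |alternatingSeq a (i + 2 * l + 1)|) * alternatingKernel a i (i + 2 * l + 1)) := by
  have h : (-1 : ℝ) ^ (i + 2 * l + 1) = -(-1) ^ i := by
    rw [pow_succ, pow_add, pow_mul]; simp
  rw [neg_one_pow_mul_abs_sub_mul ha h]
  have h1 : (3 : ℝ) * 3 ^ i ≤ 3 ^ (i + 2 * l + 1) := by
    rw [← pow_succ']
    exact pow_le_pow_right₀ (by norm_num) (by omega)
  have h2 : (1 / 2 : ℝ) ≤ (3 ^ (i + 2 * l + 1) - 3 ^ i) / (3 ^ (i + 2 * l + 1) + 3 ^ i) := by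
    rw [div_le_div_iff₀ two_pos (by positivity)]
    linarith
  have h3 : (1 / 2 : ℝ) * ((l + 1 : ℕ) : ℝ)⁻¹ ≤ (((i + 2 * l + 1 : ℕ) : ℝ) - i)⁻¹ := by
    push_cast
    rw [show (i : ℝ) + 2 * l + 1 - i = 2 * l + 1 by ring, one_div, ← mul_inv]
    gcongr
    linarith
  calc (1 / 4 : ℝ) * ((l + 1 : ℕ) : ℝ)⁻¹ = 1 / 2 * (1 / 2 * ((l + 1 : ℕ) : ℝ)⁻¹) := by ring
    _ ≤ _ := mul_le_mul h2 h3 (by positivity) (by linarith)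

lemma log_mul_le_sum {a : ℝ} (ha : 0 < a) (n : ℕ) :
    n / 4 * Real.log (n + 1) ≤ ∑ i : Fin (3 * n), ∑ j : Fin (3 * n), (-1) ^ (i : ℕ) *
      ((|alternatingSeq a i| - |alternatingSeq a j|) * alternatingKernel a i j) := by
  set f : ℕ → ℕ → ℝ := fun i j => (-1) ^ i *
    ((|alternatingSeq a i| - |alternatingSeq a j|) * alternatingKernel a i j) with hf
  have hf0 : ∀ i j, 0 ≤ f i j := neg_one_pow_mul_abs_sub_mul_nonneg ha
  have e : ∑ i : Fin (3 * n), ∑ j : Fin (3 * n), (-1) ^ (i : ℕ) *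
      ((|alternatingSeq a i| - |alternatingSeq a j|) * alternatingKernel a i j) =
        ∑ i ∈ Finset.range (3 * n), ∑ j ∈ Finset.range (3 * n), f i j := by
    rw [← Fin.sum_univ_eq_sum_range (fun i => ∑ j ∈ Finset.range (3 * n), f i j)]
    exact Finset.sum_congr rfl fun i _ => Fin.sum_univ_eq_sum_range (f i) _
  rw [e]
  have h1 : ∀ i ∈ Finset.range n,
      1 / 4 * Real.log (n + 1) ≤ ∑ j ∈ Finset.range (3 * n), f i j := by
    intro i hi
    have h2 : ∑ l ∈ Finset.range n, f i (i + 2 * l + 1) ≤ ∑ j ∈ Finset.range (3 * n), f i j := by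
      rw [← Finset.sum_image (f := f i) (g := fun l => i + 2 * l + 1)
        (fun x _ y _ h => by simp only at h; omega)]
      refine Finset.sum_le_sum_of_subset_of_nonneg ?_ fun j _ _ => hf0 i j
      intro j hj
      obtain ⟨l, hl, rfl⟩ := Finset.mem_image.1 hj
      simp only [Finset.mem_range] at hi hl ⊢
      omega
    refine le_trans ?_ h2
    have h3 := log_add_one_le_harmonic n
    rw [harmonic] at h3
    push_cast at h3
    refine (mul_le_mul_of_nonneg_left h3 (by norm_num)).trans ?_
    rw [Finset.mul_sum]
    refine Finset.sum_le_sum fun l _ => ?_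
    have := le_neg_one_pow_mul_abs_sub_mul ha i l
    push_cast at this
    simpa only [hf] using this
  calc (n : ℝ) / 4 * Real.log (n + 1) = ∑ i ∈ Finset.range n, 1 / 4 * Real.log (n + 1) := by
        rw [Finset.sum_const, Finset.card_range, nsmul_eq_mul]; ring
    _ ≤ ∑ i ∈ Finset.range n, ∑ j ∈ Finset.range (3 * n), f i j := Finset.sum_le_sum h1
    _ ≤ _ := Finset.sum_le_sum_of_subset_of_nonneg
      (Finset.range_subset_range.2 (by omega))
      fun i _ _ => Finset.sum_nonneg fun j _ => hf0 i j

lemma re_sum_sum_le {N : ℕ} (M : Matrix (Fin N) (Fin N) ℂ) (s : Fin N → ℂ)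
    (hs : ∀ i, ‖s i‖ = 1) : (∑ i, ∑ j, star (s i) * M i j).re ≤ N * ‖M‖ := by
  have h1 : ∀ v : Fin N → ℂ, (∀ i, ‖v i‖ = 1) →
      ‖(WithLp.toLp 2 v : EuclideanSpace ℂ (Fin N))‖ = √N := by
    intro v hv
    simp [EuclideanSpace.norm_eq, hv]
  have h2 := l2_opNorm_mulVec M (WithLp.toLp 2 fun _ => 1)
  rw [h1 (fun _ => 1) (by simp)] at h2
  have h3 := norm_inner_le_norm (𝕜 := ℂ) (WithLp.toLp 2 s : EuclideanSpace ℂ (Fin N))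
    (WithLp.toLp 2 (M *ᵥ fun _ => 1))
  rw [h1 s hs] at h3
  have e : inner ℂ (WithLp.toLp 2 s : EuclideanSpace ℂ (Fin N)) (WithLp.toLp 2 (M *ᵥ fun _ => 1)) =
      ∑ i, ∑ j, star (s i) * M i j := by
    simp only [PiLp.inner_apply, RCLike.inner_apply, mulVec, dotProduct, mul_one, Finset.sum_mul]
    exact Finset.sum_congr rfl fun i _ => Finset.sum_congr rfl fun j _ => mul_comm _ _
  rw [← e]
  refine (Complex.re_le_norm _).trans (h3.trans ?_)
  calc √N * _ ≤ √N * (‖M‖ * √N) := by gcongr; exact h2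
    _ = (√N * √N) * ‖M‖ := by ring
    _ = N * ‖M‖ := by rw [Real.mul_self_sqrt (Nat.cast_nonneg _)]

lemma diagonal_mul_sub_mul_diagonal {N : ℕ} (d : Fin N → ℝ) (k : Fin N → Fin N → ℝ) :
    diagonal (fun i => (d i : ℂ)) * of (fun i j => (k i j : ℂ)) -
      of (fun i j => (k i j : ℂ)) * diagonal (fun i => (d i : ℂ)) =
        of fun i j => (((d i - d j) * k i j : ℝ) : ℂ) := by
  ext i j
  rw [Matrix.sub_apply, diagonal_mul, mul_diagonal, of_apply, of_apply]
  push_cast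
  ring

lemma norm_alternating_hilbert_le (N : ℕ) :
    ‖(of fun i j : Fin N => (((1 - (-1) ^ (i : ℕ) * (-1) ^ (j : ℕ)) / 2 *
      ((i : ℝ) - j)⁻¹ : ℝ) : ℂ) : Matrix (Fin N) (Fin N) ℂ)‖ ≤ 4 := by
  set S : Matrix (Fin N) (Fin N) ℂ := diagonal fun i => (-1) ^ (i : ℕ) with hS
  have hS1 : ‖S‖ ≤ 1 := by
    rw [hS, l2_opNorm_diagonal]
    exact (pi_norm_le_iff_of_nonneg zero_le_one).2 fun i => by simp
  have e : (of fun i j : Fin N => (((1 - (-1) ^ (i : ℕ) * (-1) ^ (j : ℕ)) / 2 *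
      ((i : ℝ) - j)⁻¹ : ℝ) : ℂ) : Matrix (Fin N) (Fin N) ℂ) =
        (1 / 2 : ℂ) • (hilbertMatrix N - S * hilbertMatrix N * S) := by
    ext i j
    rw [Matrix.smul_apply, Matrix.sub_apply, hS, mul_diagonal, diagonal_mul, hilbertMatrix,
      of_apply, of_apply]
    push_cast
    rw [smul_eq_mul]
    ring
  have h := norm_hilbertMatrix_le N
  have h2 : ‖S * hilbertMatrix N * S‖ ≤ 1 * 4 * 1 := by
    refine norm_mul₃_le.trans ?_
    gcongr
  rw [e, norm_smul]
  have := norm_sub_le (hilbertMatrix N) (S * hilbertMatrix N * S)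
  norm_num
  linarith

lemma exists_unitary_log_mul_norm_le {a : ℝ} (ha : 0 < a) {n : ℕ} (hn : 0 < n) :
    ∃ U ∈ unitary (Matrix (Fin (3 * n)) (Fin (3 * n)) ℂ),
      let D : Matrix (Fin (3 * n)) (Fin (3 * n)) ℂ := diagonal fun i => (alternatingSeq a i : ℂ)
      let F : Matrix (Fin (3 * n)) (Fin (3 * n)) ℂ :=
        diagonal fun i => ((|alternatingSeq a i| : ℝ) : ℂ)
      Real.log (n + 1) / 432 * ‖D - U * D * star U‖ ≤ ‖F - U * F * star U‖ ∧
        0 < ‖F - U * F * star U‖ := by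
  have : NeZero (3 * n) := ⟨by omega⟩
  set K : Matrix (Fin (3 * n)) (Fin (3 * n)) ℂ :=
    of fun i j => ((alternatingKernel a i j : ℝ) : ℂ) with hK
  have hKs : IsSelfAdjoint K := by
    ext i j
    rw [star_eq_conjTranspose, conjTranspose_apply, hK, of_apply, of_apply,
      alternatingKernel_comm, ← starRingEnd_apply, Complex.conj_ofReal]
  obtain ⟨U, hU, t, ht, h⟩ := exists_unitary_norm_sub_conj hKs
  refine ⟨U, hU, ?_⟩
  intro D F
  have hlog : 0 < Real.log (n + 1) := Real.log_pos (by
    have : (0 : ℝ) < n := by exact_mod_cast hn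
    linarith)
  have hD : ‖D * K - K * D‖ ≤ 4 := by
    rw [diagonal_mul_sub_mul_diagonal]
    simp only [sub_mul_alternatingKernel ha]
    exact norm_alternating_hilbert_le _
  have hF : Real.log (n + 1) / 12 ≤ ‖F * K - K * F‖ := by
    have h1 := re_sum_sum_le (F * K - K * F) (fun i => (-1) ^ (i : ℕ)) (by simp)
    rw [diagonal_mul_sub_mul_diagonal] at h1 ⊢
    have h2 := log_mul_le_sum ha n
    have e : ∑ i : Fin (3 * n), ∑ j : Fin (3 * n), star ((-1 : ℂ) ^ (i : ℕ)) *
        (of fun i j : Fin (3 * n) => (((|alternatingSeq a i| - |alternatingSeq a j|) *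
          alternatingKernel a i j : ℝ) : ℂ)) i j = ((∑ i : Fin (3 * n), ∑ j : Fin (3 * n),
          (-1) ^ (i : ℕ) * ((|alternatingSeq a i| - |alternatingSeq a j|) *
            alternatingKernel a i j) : ℝ) : ℂ) := by
      push_cast
      simp
    rw [e, Complex.ofReal_re] at h1
    have h3 := h2.trans h1
    have hn' : (0 : ℝ) < n := by exact_mod_cast hn
    rw [Nat.cast_mul, Nat.cast_ofNat] at h3
    refine le_of_mul_le_mul_left ?_ (mul_pos three_pos hn')
    refine le_trans (le_of_eq ?_) h3
    ring
  have h1 := (h D).1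
  have h2 := (h F).2
  have h3 : 8 / 9 * t * (Real.log (n + 1) / 12) ≤ ‖F - U * F * star U‖ := le_trans (by gcongr) h2
  have h4 : ‖D - U * D * star U‖ ≤ 8 * t * 4 := h1.trans (by gcongr)
  refine ⟨?_, lt_of_lt_of_le (by positivity) h3⟩
  refine le_trans ?_ h3
  calc Real.log (n + 1) / 432 * ‖D - U * D * star U‖ ≤ Real.log (n + 1) / 432 * (8 * t * 4) := by
        gcongr
    _ = _ := by ring

end Lacunary

section Embedding

open scoped Matrix.Norms.L2Operator
open Matrix

lemma exists_linearIsometry_ellTwo (N : ℕ) :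
    Nonempty (EuclideanSpace ℂ (Fin N) →ₗᵢ[ℂ] ellTwo) := by
  have w : HilbertBasis ℕ ℂ ellTwo := default
  set v := (EuclideanSpace.basisFun (Fin N) ℂ).toBasis
  have hv : Orthonormal ℂ v := by
    rw [OrthonormalBasis.coe_toBasis]
    exact (EuclideanSpace.basisFun (Fin N) ℂ).orthonormal
  refine ⟨(v.constr ℂ fun i => w (i : ℕ)).isometryOfOrthonormal hv ?_⟩
  have : (v.constr ℂ fun i => w (i : ℕ)) ∘ v = fun i : Fin N => w (i : ℕ) := by
    ext1 i
    exact v.constr_basis ℂ _ i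
  rw [this]
  exact w.orthonormal.comp _ Fin.val_injective

/-- The corner embedding of operator algebras induced by an isometry of Hilbert spaces. -/
noncomputable def cornerHom {E H : Type*} [NormedAddCommGroup E] [InnerProductSpace ℂ E]
    [CompleteSpace E] [NormedAddCommGroup H] [InnerProductSpace ℂ H] [CompleteSpace H]
    (J : E →ₗᵢ[ℂ] H) : (E →L[ℂ] E) →⋆ₙₐ[ℂ] (H →L[ℂ] H) where
  toFun T := J.toContinuousLinearMap ∘L T ∘L adjoint J.toContinuousLinearMap
  map_smul' c T := by ext; simp
  map_zero' := by ext; simp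
  map_add' S T := by ext; simp
  map_mul' S T := by
    have h := J.adjoint_comp_self
    ext x
    have := DFunLike.congr_fun h (T (adjoint J.toContinuousLinearMap x))
    simp only [ContinuousLinearMap.comp_apply] at this
    simp only [mul_apply_eq_comp, ContinuousLinearMap.comp_apply, this]
    rfl
  map_star' T := by
    simp only [star_eq_adjoint, adjoint_comp, adjoint_adjoint]
    rfl

lemma exists_isometric_starHom_ellTwo (N : ℕ) :
    ∃ ψ : Matrix (Fin N) (Fin N) ℂ →⋆ₙₐ[ℂ] (ellTwo →L[ℂ] ellTwo), ∀ M, ‖ψ M‖ = ‖M‖ := by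
  obtain ⟨J⟩ := exists_linearIsometry_ellTwo N
  set e : Matrix (Fin N) (Fin N) ℂ →⋆ₙₐ[ℂ]
    (EuclideanSpace ℂ (Fin N) →L[ℂ] EuclideanSpace ℂ (Fin N)) :=
    { toFun := toEuclideanCLM (n := Fin N) (𝕜 := ℂ)
      map_smul' := fun c M => map_smul _ c M
      map_zero' := map_zero _
      map_add' := map_add _
      map_mul' := map_mul _
      map_star' := map_star _ }
  refine ⟨(cornerHom J).comp e, fun M => NonUnitalStarAlgHom.norm_map _ ?_ M⟩
  intro S T hST
  refine (toEuclideanCLM (n := Fin N) (𝕜 := ℂ)).injective ?_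
  have h := J.adjoint_comp_self
  have h2 : ∀ X, adjoint J.toContinuousLinearMap ∘L (cornerHom J X) ∘L J.toContinuousLinearMap =
      X := by
    intro X
    calc adjoint J.toContinuousLinearMap ∘L (cornerHom J X) ∘L J.toContinuousLinearMap =
        (adjoint J.toContinuousLinearMap ∘L J.toContinuousLinearMap) ∘L X ∘L
          (adjoint J.toContinuousLinearMap ∘L J.toContinuousLinearMap) := rfl
      _ = X := by rw [h]; rfl
  calc e S = _ := (h2 (e S)).symm
    _ = _ := by
      have : cornerHom J (e S) = cornerHom J (e T) := hST
      rw [this]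
    _ = e T := h2 (e T)

lemma opAbs_eq_of_mul_self_eq {H : Type} [NormedAddCommGroup H] [InnerProductSpace ℂ H]
    [CompleteSpace H] {X Y : H →L[ℂ] H} (hY : 0 ≤ Y) (h : Y * Y = star X * X) : opAbs X = Y := by
  rw [opAbs, ← cfcₙ_eq_cfc, ← CFC.sqrt_eq_real_sqrt _ (star_mul_self_nonneg X)]
  exact CFC.sqrt_unique h hY

lemma spectrum_diagonal_ofReal_subset {N : ℕ} (d : Fin N → ℝ) :
    spectrum ℝ (diagonal fun i => (d i : ℂ)) ⊆ Set.range d := by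
  intro x hx
  have hdet : (algebraMap ℝ (Matrix (Fin N) (Fin N) ℂ) x - diagonal fun i => (d i : ℂ)).det = 0 := by
    by_contra h
    exact hx ((Matrix.isUnit_iff_isUnit_det _).2 (isUnit_iff_ne_zero.2 h))
  rw [Matrix.algebraMap_eq_diagonal, diagonal_sub, det_diagonal, Finset.prod_eq_zero_iff] at hdet
  obtain ⟨i, -, hi⟩ := hdet
  refine ⟨i, ?_⟩
  rw [sub_eq_zero] at hi
  exact Complex.ofReal_injective hi.symm

lemma conj_diagonal_properties {N : ℕ} (d : Fin N → ℝ)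
    (ψ : Matrix (Fin N) (Fin N) ℂ →⋆ₙₐ[ℂ] (ellTwo →L[ℂ] ellTwo))
    {U : Matrix (Fin N) (Fin N) ℂ} (hU : U ∈ unitary (Matrix (Fin N) (Fin N) ℂ)) :
    IsSelfAdjoint (ψ (U * diagonal (fun i => (d i : ℂ)) * star U)) ∧
    spectrum ℝ (ψ (U * diagonal (fun i => (d i : ℂ)) * star U)) ⊆ insert 0 (Set.range d) ∧
    opAbs (ψ (U * diagonal (fun i => (d i : ℂ)) * star U)) =
      ψ (U * diagonal (fun i => ((|d i| : ℝ) : ℂ)) * star U) := by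
  have hstar : ∀ f : Fin N → ℝ, star (diagonal fun i => (f i : ℂ)) = diagonal fun i => (f i : ℂ) := by
    intro f
    rw [star_eq_conjTranspose, diagonal_conjTranspose]
    congr 1
    ext i
    simp
  have hsa : ∀ f : Fin N → ℝ, IsSelfAdjoint (U * diagonal (fun i => (f i : ℂ)) * star U) :=
    fun f => IsSelfAdjoint.conjugate (hstar f) U
  have hmul : ∀ f g : Fin N → ℝ, (U * diagonal (fun i => (f i : ℂ)) * star U) *
      (U * diagonal (fun i => (g i : ℂ)) * star U) =
        U * diagonal (fun i => ((f i * g i : ℝ) : ℂ)) * star U := by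
    intro f g
    calc _ = U * diagonal (fun i => (f i : ℂ)) * (star U * U) * diagonal (fun i => (g i : ℂ)) *
          star U := by noncomm_ring
      _ = _ := by
        rw [(Unitary.mem_iff.1 hU).1, mul_one, mul_assoc U, diagonal_mul_diagonal]
        push_cast
        rfl
  refine ⟨(hsa d).map ψ, ?_, ?_⟩
  · intro x hx
    have h1 := NonUnitalAlgHom.quasispectrum_apply_subset' ℂ ψ _
      (spectrum_subset_quasispectrum ℝ _ hx)
    rw [mem_quasispectrum_iff] at h1
    rcases h1 with h1 | h1
    · exact Or.inl h1
    · right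
      have h2 := Unitary.spectrum_star_right_conjugate (R := ℝ)
        (a := diagonal fun i => (d i : ℂ)) (U := ⟨U, hU⟩)
      exact spectrum_diagonal_ofReal_subset d (h2 ▸ h1)
  · refine opAbs_eq_of_mul_self_eq ?_ ?_
    · have e : U * diagonal (fun i => ((|d i| : ℝ) : ℂ)) * star U =
          star (U * diagonal (fun i => ((√|d i| : ℝ) : ℂ)) * star U) *
            (U * diagonal (fun i => ((√|d i| : ℝ) : ℂ)) * star U) := by
        rw [hsa, hmul]
        simp only [Real.mul_self_sqrt (abs_nonneg _)]
      rw [e, map_mul, map_star]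
      exact star_mul_self_nonneg _
    · rw [← map_star, ← map_mul, ← map_mul, hsa, hmul, hmul]
      simp only [abs_mul_abs_self]

end Embedding

section LowerBound

open scoped Matrix.Norms.L2Operator
open Matrix

lemma exists_ellTwo_of_matrix {N : ℕ} {a b : ℝ} (hb : 0 < b) (d d' : Fin N → ℝ)
    (hd : Set.range d ⊆ Set.Ioc (-b) 0 ∪ Set.Ici a)
    (hd' : Set.range d' ⊆ Set.Ioc (-b) 0 ∪ Set.Ici a)
    {U : Matrix (Fin N) (Fin N) ℂ} (hU : U ∈ unitary (Matrix (Fin N) (Fin N) ℂ)) {c : ℝ}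
    (hpos : 0 < ‖(diagonal (fun i => ((|d i| : ℝ) : ℂ)) : Matrix (Fin N) (Fin N) ℂ) -
      U * diagonal (fun i => ((|d' i| : ℝ) : ℂ)) * star U‖)
    (hle : c * ‖(diagonal (fun i => (d i : ℂ)) : Matrix (Fin N) (Fin N) ℂ) -
      U * diagonal (fun i => (d' i : ℂ)) * star U‖ ≤
        ‖(diagonal (fun i => ((|d i| : ℝ) : ℂ)) : Matrix (Fin N) (Fin N) ℂ) -
          U * diagonal (fun i => ((|d' i| : ℝ) : ℂ)) * star U‖) :
    ∃ A B : ellTwo →L[ℂ] ellTwo, IsSelfAdjoint A ∧ IsSelfAdjoint B ∧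
      spectrum ℝ A ⊆ Set.Ioc (-b) 0 ∪ Set.Ici a ∧ spectrum ℝ B ⊆ Set.Ioc (-b) 0 ∪ Set.Ici a ∧
      A ≠ B ∧ c * ‖A - B‖ ≤ ‖opAbs A - opAbs B‖ := by
  obtain ⟨ψ, hψ⟩ := exists_isometric_starHom_ellTwo N
  obtain ⟨hA1, hA2, hA3⟩ := conj_diagonal_properties d ψ (one_mem (unitary _))
  obtain ⟨hB1, hB2, hB3⟩ := conj_diagonal_properties d' ψ hU
  simp only [one_mul, star_one, mul_one] at hA1 hA2 hA3
  have h0 : (0 : ℝ) ∈ Set.Ioc (-b) 0 ∪ Set.Ici a := Or.inl ⟨by linarith, le_rfl⟩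
  refine ⟨_, _, hA1, hB1, hA2.trans (Set.insert_subset h0 hd),
    hB2.trans (Set.insert_subset h0 hd'), fun h => ?_, ?_⟩
  · rw [← hψ, map_sub, ← hA3, ← hB3, h, sub_self, norm_zero] at hpos
    exact lt_irrefl _ hpos
  · rwa [hA3, hB3, ← map_sub, ← map_sub, hψ, hψ]

lemma range_alternatingSeq_subset {a b : ℝ} (ha : 0 < a) {N : ℕ} (hN : a * 3 ^ N ≤ b) :
    Set.range (fun i : Fin N => alternatingSeq a i) ⊆ Set.Ioc (-b) 0 ∪ Set.Ici a := by
  rintro _ ⟨i, rfl⟩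
  have h1 : (1 : ℝ) ≤ 3 ^ (i : ℕ) := one_le_pow₀ (by norm_num)
  have h2 : (3 : ℝ) ^ (i : ℕ) < 3 ^ N := pow_lt_pow_right₀ (by norm_num) i.2
  rcases neg_one_pow_eq_or ℝ (i : ℕ) with h | h
  · right
    simp only [alternatingSeq, h, one_mul, Set.mem_Ici]
    exact le_mul_of_one_le_right ha.le h1
  · left
    simp only [alternatingSeq, h, neg_one_mul]
    have := mul_lt_mul_of_pos_left h2 ha
    exact ⟨by linarith, by nlinarith⟩

lemma exists_ellTwo_log_mul_norm_sub_le {a b : ℝ} (ha : 0 < a) (hb : 0 < b) :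
    ∃ A B : ellTwo →L[ℂ] ellTwo, IsSelfAdjoint A ∧ IsSelfAdjoint B ∧
      spectrum ℝ A ⊆ Set.Ioc (-b) 0 ∪ Set.Ici a ∧ spectrum ℝ B ⊆ Set.Ioc (-b) 0 ∪ Set.Ici a ∧
      A ≠ B ∧ 1 / 1728 * Real.log (2 + max (Real.log (b / a)) 0) * ‖A - B‖ ≤
        ‖opAbs A - opAbs B‖ := by
  set L := max (Real.log (b / a)) 0 with hL
  have hL0 : 0 ≤ L := le_max_right _ _
  rcases lt_or_ge L 4 with h4 | h4
  · have hlog : Real.log (2 + L) ≤ 5 := by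
      have := Real.log_le_sub_one_of_pos (show 0 < 2 + L by linarith)
      linarith
    have hr : ∀ x : ℝ, a ≤ x →
        Set.range (fun _ : Fin 1 => x) ⊆ Set.Ioc (-b) 0 ∪ Set.Ici a := by
      rintro x hx _ ⟨i, rfl⟩
      exact Or.inr hx
    have e : ‖(diagonal (fun _ => ((a : ℝ) : ℂ)) : Matrix (Fin 1) (Fin 1) ℂ) -
      1 * diagonal (fun _ => ((2 * a : ℝ) : ℂ)) * star 1‖ = a := by
      rw [star_one, one_mul, mul_one, diagonal_sub, l2_opNorm_diagonal]
      simp only [Pi.norm_def, Finset.univ_unique, Finset.sup_singleton, coe_nnnorm]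
      rw [← Complex.ofReal_sub, Complex.norm_real, Real.norm_eq_abs,
        show a - 2 * a = -a by ring, abs_neg, abs_of_pos ha]
    refine exists_ellTwo_of_matrix hb _ _ (hr a le_rfl) (hr (2 * a) (by linarith))
      (one_mem (unitary _)) ?_ ?_
    · rw [abs_of_pos ha, abs_of_pos (by positivity), e]
      exact ha
    · rw [abs_of_pos ha, abs_of_pos (by positivity), e]
      nlinarith
  · set n := ⌊L / 4⌋₊ with hn
    have hn1 : 1 ≤ n := Nat.le_floor (by push_cast; linarith)
    have hn1' : (1 : ℝ) ≤ n := by exact_mod_cast hn1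
    have hnL : (n : ℝ) ≤ L / 4 := Nat.floor_le (by linarith)
    have hLn : L / 4 < n + 1 := Nat.lt_floor_add_one _
    have hLeq : L = Real.log (b / a) := by
      rcases max_choice (Real.log (b / a)) 0 with h | h
      · rw [hL, h]
      · rw [← hL] at h; linarith
    have h27 : a * 3 ^ (3 * n) ≤ b := by
      have h3 : Real.log 27 ≤ 4 := by
        have h5 : Real.log 27 ≤ Real.log (2 ^ 5) :=
          Real.log_le_log (by norm_num) (by norm_num)
        rw [Real.log_pow] at h5
        have := Real.log_two_lt_d9
        push_cast at h5
        linarith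
      have h5 : Real.log (27 ^ n) ≤ Real.log (b / a) := by
        rw [Real.log_pow, ← hLeq]
        nlinarith
      rw [Real.log_le_log_iff (by positivity) (by positivity), le_div_iff₀ ha] at h5
      rw [pow_mul, mul_comm]
      norm_num
      exact h5
    have hlog : Real.log (2 + L) ≤ 4 * Real.log (n + 1) := by
      have : 4 * Real.log ((n : ℝ) + 1) = Real.log (((n : ℝ) + 1) ^ 4) := by
        rw [Real.log_pow]; norm_num
      rw [this]
      refine Real.log_le_log (by linarith) ?_
      have : ((n : ℝ) + 1) ^ 4 ≥ 8 * (n + 1) := by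
        have h2 : (2 : ℝ) ^ 3 ≤ ((n : ℝ) + 1) ^ 3 := by gcongr; linarith
        nlinarith
      linarith
    obtain ⟨U, hU, h1, h2⟩ := exists_unitary_log_mul_norm_le ha hn1
    have hr := range_alternatingSeq_subset ha h27
    refine exists_ellTwo_of_matrix hb _ _ hr hr hU h2 (le_trans ?_ h1)
    refine mul_le_mul_of_nonneg_right ?_ (norm_nonneg _)
    linarith

end LowerBound

theorem stmt4 :
    ∃ C₁ C₂ : ℝ, 0 < C₁ ∧ 0 < C₂ ∧
      ∀ a b : ℝ, 0 < a → 0 < b →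
        (∀ (H : Type) [NormedAddCommGroup H] [InnerProductSpace ℂ H] [CompleteSpace H]
          (A B : H →L[ℂ] H), IsSelfAdjoint A → IsSelfAdjoint B →
          spectrum ℝ A ⊆ Set.Ioc (-b) 0 ∪ Set.Ici a →
          spectrum ℝ B ⊆ Set.Ioc (-b) 0 ∪ Set.Ici a →
          ‖opAbs A - opAbs B‖ ≤
            C₂ * Real.log (2 + max (Real.log (b / a)) 0) * ‖A - B‖) ∧
        (∃ A B : ellTwo →L[ℂ] ellTwo,
          IsSelfAdjoint A ∧ IsSelfAdjoint B ∧
          spectrum ℝ A ⊆ Set.Ioc (-b) 0 ∪ Set.Ici a ∧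
          spectrum ℝ B ⊆ Set.Ioc (-b) 0 ∪ Set.Ici a ∧ A ≠ B ∧
          C₁ * Real.log (2 + max (Real.log (b / a)) 0) * ‖A - B‖ ≤
            ‖opAbs A - opAbs B‖) := by
  refine ⟨1 / 1728, 49, by norm_num, by norm_num, fun a b ha hb => ⟨?_, ?_⟩⟩
  · intro H _ _ _ A B hA hB hAs hBs
    obtain ⟨k, hk, hk'⟩ := exists_nat_pow_pow_mul_ge ha hb
    exact (norm_opAbs_sub_le hA hB ha hb hAs hBs hk).trans
      (mul_le_mul_of_nonneg_right hk' (norm_nonneg _))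
  · exact exists_ellTwo_log_mul_norm_sub_le ha hb
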